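/- arXiv:1207.5132 — 7 statements merged into one kernel-verified Lean document; each statement's English description precedes it below -/
import Mathlib

section
/- Every 2-connected (K1 ∪ K1 ∪ K1)-free graph on n ≥ 3 vertices is hamiltonian. -/
/-- A graph `G` is `H`-free if it contains no induced subgraph isomorphic to `H`,
i.e. there is no graph embedding of `H` into `G`. -/
def InducedFree {W V : Type*} (H : SimpleGraph W) (G : SimpleGraph V) : Prop :=
  ¬ Nonempty (H ↪g G)

/-- `K1 ∪ K1 ∪ K1`: three isolated vertices, i.e. the empty graph on three vertices. -/
def K1K1K1 : SimpleGraph (Fin 3) := ⊥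

theorem List.IsChain.append_of_mem {α : Type*} {R : α → α → Prop} {l₁ l₂ : List α}
    (h₁ : l₁.IsChain R) (h₂ : l₂.IsChain R) {x y : α} (hx : x ∈ l₁.getLast?) (hy : y ∈ l₂.head?)
    (h : R x y) : (l₁ ++ l₂).IsChain R := by
  refine h₁.append h₂ fun x' hx' y' hy' => ?_
  rwa [Option.mem_unique hx' hx, Option.mem_unique hy' hy]

/-- A list splits before the first entry satisfying a given property. -/
theorem List.exists_eq_append_cons_of_first {α : Type*} {p : α → Prop} :
    ∀ {l : List α}, (∃ c ∈ l, p c) → ∃ A c B, l = A ++ c :: B ∧ p c ∧ ∀ z ∈ A, ¬ p z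
  | [], h => by simp at h
  | x :: l, h => by
    by_cases hx : p x
    · exact ⟨[], x, l, by simp [hx]⟩
    · obtain ⟨A, c, B, rfl, hc, hA⟩ :=
        exists_eq_append_cons_of_first (l := l) (by simpa [hx] using h)
      exact ⟨x :: A, c, B, by simpa [hx, hc] using hA⟩

namespace SimpleGraph

variable {V : Type*} {G : SimpleGraph V}

/-- A spanning cycle given as a duplicate-free list of all vertices, with consecutive vertices
adjacent and the last vertex adjacent to the first. -/
theorem IsHamiltonian.of_isChain [Fintype V] [DecidableEq V] (hn : 3 ≤ Fintype.card V)
    {l : List V} (hc : l.IsChain G.Adj) (hd : l.Nodup) (hall : ∀ v, v ∈ l)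
    {x y : V} (hx : x ∈ l.getLast?) (hy : y ∈ l.head?) (hxy : G.Adj x y) : G.IsHamiltonian := by
  intro _
  have hne : l ≠ [] := by rintro rfl; simp at hx
  have hx' : l.getLast hne = x := by simpa [List.getLast?_eq_some_getLast hne] using hx
  have hy' : l.head hne = y := by simpa [List.head?_eq_some_head hne] using hy
  let p := Walk.ofSupport l hne hc
  have hp : p.support = l := Walk.support_ofSupport hne hc
  have hpath : p.IsPath := by rw [Walk.isPath_def, hp]; exact hd
  have hham : p.IsHamiltonian := hpath.isHamiltonian_of_mem (by rw [hp]; exact hall)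
  have hadj : G.Adj (l.getLast hne) (l.head hne) := by rw [hx', hy']; exact hxy
  refine ⟨_, Walk.cons hadj p, ?_⟩
  rw [Walk.isHamiltonianCycle_iff_isCycle_and_length_eq]
  have hlen := hham.length_eq
  refine ⟨(Walk.cons_isCycle_iff _ _).2 ⟨hpath, fun he => ?_⟩, by simp; omega⟩
  have := hpath.length_eq_one_of_mem_edges (Sym2.eq_swap ▸ he)
  omega

/-- A clique can be traversed from any of its vertices to any other one. -/
theorem exists_perm_isChain_of_clique [DecidableEq V] {L : List V}
    (hL : ∀ u ∈ L, ∀ v ∈ L, u ≠ v → G.Adj u v) (hd : L.Nodup) {x y : V} (hx : x ∈ L) (hy : y ∈ L)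
    (hxy : x ≠ y) : ∃ M : List V, M.Perm L ∧ M.IsChain G.Adj ∧ x ∈ M.head? ∧ y ∈ M.getLast? := by
  have h1 : L.Perm (x :: L.erase x) := List.perm_cons_erase hx
  have h2 : (L.erase x).Perm (y :: (L.erase x).erase y) :=
    List.perm_cons_erase ((List.mem_erase_of_ne hxy.symm).2 hy)
  have h3 : (x :: ((L.erase x).erase y ++ [y])).Perm L :=
    ((h2.trans (List.perm_append_singleton _ _).symm).cons x).symm.trans h1.symm
  refine ⟨_, h3, ?_, by simp, by simp [List.getLast?_cons]⟩
  refine List.Pairwise.isChain ?_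
  refine List.Pairwise.imp_of_mem ?_ (h3.nodup_iff.2 hd)
  intro a b ha hb hab
  exact hL a (h3.mem_iff.1 ha) b (h3.mem_iff.1 hb) hab

/-- Two disjoint cliques covering the graph and joined by two disjoint edges yield a Hamiltonian
cycle. -/
theorem IsHamiltonian.of_two_cliques [Fintype V] [DecidableEq V] (hn : 3 ≤ Fintype.card V)
    {A B : List V} (hA : ∀ u ∈ A, ∀ v ∈ A, u ≠ v → G.Adj u v)
    (hB : ∀ u ∈ B, ∀ v ∈ B, u ≠ v → G.Adj u v)
    (hd : (A ++ B).Nodup) (hall : ∀ v, v ∈ A ++ B) {a a' b b' : V} (ha : a ∈ A) (ha' : a' ∈ A)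
    (hb : b ∈ B) (hb' : b' ∈ B) (haa : a ≠ a') (hbb : b ≠ b') (hab : G.Adj a b)
    (hab' : G.Adj a' b') : G.IsHamiltonian := by
  have hd' := List.nodup_append'.1 hd
  obtain ⟨M, hM, hMc, hMh, hMl⟩ := exists_perm_isChain_of_clique hA hd'.1 ha' ha haa.symm
  obtain ⟨N, hN, hNc, hNh, hNl⟩ := exists_perm_isChain_of_clique hB hd'.2.1 hb hb' hbb
  have hp := hM.append hN
  refine IsHamiltonian.of_isChain (l := M ++ N) hn ?_ (hp.nodup_iff.2 hd)
    (fun v => hp.mem_iff.2 (hall v)) (x := b') (y := a') ?_ ?_ hab'.symm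
  · exact hMc.append_of_mem hNc hMl hNh hab
  · exact List.mem_getLast?_append_of_mem_getLast? hNl
  · exact List.mem_head?_append_of_mem_head? hMh

/-- Two disjoint cliques joined by an edge, together with one further vertex adjacent to both,
yield a Hamiltonian cycle. -/
theorem IsHamiltonian.of_two_cliques_of_vertex [Fintype V] [DecidableEq V]
    (hn : 3 ≤ Fintype.card V) {A B : List V} {c : V}
    (hA : ∀ u ∈ A, ∀ v ∈ A, u ≠ v → G.Adj u v)
    (hB : ∀ u ∈ B, ∀ v ∈ B, u ≠ v → G.Adj u v)
    (hd : (A ++ c :: B).Nodup) (hall : ∀ v, v ∈ A ++ c :: B) {a a' b b' : V} (ha : a ∈ A)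
    (ha' : a' ∈ A) (hb : b ∈ B) (hb' : b' ∈ B) (haa : a ≠ a') (hbb : b ≠ b') (hca : G.Adj c a)
    (hab : G.Adj a' b') (hbc : G.Adj b c) : G.IsHamiltonian := by
  have hdA : A.Nodup := by grind
  have hdB : B.Nodup := by grind
  obtain ⟨M, hM, hMc, hMh, hMl⟩ := exists_perm_isChain_of_clique hA hdA ha ha' haa
  obtain ⟨N, hN, hNc, hNh, hNl⟩ := exists_perm_isChain_of_clique hB hdB hb' hb hbb.symm
  have hp : (c :: (M ++ N)).Perm (A ++ c :: B) :=
    ((hM.append hN).cons c).trans List.perm_middle.symm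
  refine IsHamiltonian.of_isChain (l := c :: (M ++ N)) hn ?_ (hp.nodup_iff.2 hd)
    (fun v => hp.mem_iff.2 (hall v)) (x := b) (y := c) ?_ ?_ hbc
  · exact (List.isChain_singleton c).append_of_mem (hMc.append_of_mem hNc hMl hNh hab)
      (by simp) (List.mem_head?_append_of_mem_head? hMh) hca
  · exact List.mem_getLast?_append_of_mem_getLast? (l₁ := c :: M) hNl
  · simp

/-- If `G - v` is connected, every vertex set separating two of its vertices is left by an edge
avoiding `v`. -/
theorem Connected.exists_adj_boundary_of_induce_compl {v : V}
    (h : (G.induce ({v}ᶜ : Set V)).Connected) (S : Set V) {x y : V} (hxv : x ≠ v) (hyv : y ≠ v)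
    (hx : x ∈ S) (hy : y ∉ S) : ∃ i ∈ S, ∃ j ∉ S, i ≠ v ∧ j ≠ v ∧ G.Adj i j := by
  obtain ⟨p⟩ := h.preconnected ⟨x, hxv⟩ ⟨y, hyv⟩
  obtain ⟨d, -, h1, h2⟩ := p.exists_boundary_dart (Subtype.val ⁻¹' S) hx hy
  exact ⟨d.fst, h1, d.snd, h2, d.fst.2, d.snd.2, d.adj⟩

/-- A longest path is spanning if the graph is 2-connected with independence number at most 2. -/
theorem exists_isChain_forall_mem [Fintype V] [DecidableEq V] (hn : 3 ≤ Fintype.card V)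
    (hconn : ∀ v : V, (G.induce ({v}ᶜ : Set V)).Connected)
    (hind : ∀ x y z, x ≠ y → y ≠ z → x ≠ z → G.Adj x y ∨ G.Adj y z ∨ G.Adj x z) :
    ∃ l : List V, l.IsChain G.Adj ∧ l.Nodup ∧ ∀ v, v ∈ l := by
  have hV : Nonempty V := Fintype.card_pos_iff.1 (by omega)
  obtain ⟨v₀⟩ := hV
  classical
  let P : ℕ → Prop := fun k => ∃ l : List V, l.IsChain G.Adj ∧ l.Nodup ∧ l.length = k
  have hP1 : P 1 := ⟨[v₀], by simp⟩
  have hle : ∀ k, P k → k ≤ Fintype.card V := by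
    rintro k ⟨l, -, hd, rfl⟩
    exact hd.length_le_card
  obtain ⟨l, hc, hd, hlen⟩ := Nat.findGreatest_spec (P := P) (hle 1 hP1) hP1
  have hmax : ∀ k, P k → k ≤ l.length := by
    intro k hk
    rw [hlen]
    exact Nat.le_findGreatest (hle k hk) hk
  refine ⟨l, hc, hd, ?_⟩
  by_contra! hw
  obtain ⟨w, hw⟩ := hw
  have hl1 := hmax 1 hP1
  obtain ⟨u, hu⟩ : ∃ u, u ∈ l := List.exists_mem_of_length_pos hl1
  obtain ⟨v, hv⟩ : ∃ v, v ∉ ({w, u} : Finset V) := by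
    by_contra! h
    have : Fintype.card V ≤ ({w, u} : Finset V).card :=
      Finset.card_le_card (s := Finset.univ) fun z _ => h z
    have := Finset.card_le_two (a := w) (b := u)
    omega
  obtain ⟨x, hx, y, hy, -, -, hxy⟩ := (hconn v).exists_adj_boundary_of_induce_compl
    {z | z ∉ l} (x := w) (y := u) (by grind) (by grind) hw (by simpa using hu)
  obtain ⟨l₁, l₂, rfl⟩ := List.append_of_mem (show y ∈ l by simpa using hy)
  have hnot : ∀ m : List V, m.Perm (l₁ ++ y :: l₂) → m.IsChain G.Adj →
      ∀ z ∈ m.head?, ¬ G.Adj x z := by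
    intro m hm hmc z hz hxz
    have := hmax ((x :: m).length) ⟨x :: m, ?_, ?_, rfl⟩
    · simp [hm.length_eq] at this
    · exact (List.isChain_singleton x).append_of_mem hmc (by simp) hz hxz
    · rw [List.nodup_cons, hm.mem_iff, hm.nodup_iff]; exact ⟨hx, hd⟩
  rcases l₁ with _ | ⟨a, l₁⟩
  · exact hnot _ (List.Perm.refl _) hc y (by simp) hxy
  obtain ⟨b, hb⟩ : ∃ b, b ∈ (y :: l₂).getLast? := by
    rw [List.getLast?_eq_some_getLast (by simp)]; simp
  have hbm : b ∈ y :: l₂ := List.mem_of_getLast? hb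
  have hxa : ¬ G.Adj x a := hnot _ (List.Perm.refl _) hc a (by simp)
  have hxb : ¬ G.Adj x b := by
    refine hnot _ (List.reverse_perm _) ?_ b ?_
    · rw [List.isChain_reverse]
      exact hc.imp fun _ _ h => h.symm
    · rw [List.head?_reverse]
      exact List.mem_getLast?_append_of_mem_getLast? hb
  have hab : G.Adj a b := by
    have := hind x a b (by grind) (by grind) (by grind)
    tauto
  refine hnot ((y :: l₂) ++ (a :: l₁)) List.perm_append_comm ?_ y (by simp) hxy
  rw [List.isChain_append] at hc
  exact hc.2.1.append_of_mem hc.1 hb (by simp) hab.symm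

/-- The Chvátal–Erdős theorem for independence number at most 2. -/
theorem isHamiltonian_of_no_independent_triple [Fintype V] [DecidableEq V]
    (hn : 3 ≤ Fintype.card V)
    (hconn : ∀ v : V, (G.induce ({v}ᶜ : Set V)).Connected)
    (hind : ∀ x y z, x ≠ y → y ≠ z → x ≠ z → G.Adj x y ∨ G.Adj y z ∨ G.Adj x z) :
    G.IsHamiltonian := by
  obtain ⟨l, hc, hd, hall⟩ := exists_isChain_forall_mem hn hconn hind
  by_contra hG
  have hne : l ≠ [] := by
    rintro rfl
    have : Nonempty V := Fintype.card_pos_iff.1 (by omega)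
    simpa using hall this.some
  obtain ⟨a, ha⟩ : ∃ a, a ∈ l.head? := by
    rw [List.head?_eq_some_head hne]; simp
  obtain ⟨b, hb⟩ : ∃ b, b ∈ l.getLast? := by
    rw [List.getLast?_eq_some_getLast hne]; simp
  have hba : ¬ G.Adj b a := fun h => hG (.of_isChain hn hc hd hall hb ha h)
  have hlen : 3 ≤ l.length := by
    have : Finset.univ ⊆ l.toFinset := fun v _ => by simpa using hall v
    have := Finset.card_le_card this
    have := l.toFinset_card_le
    rw [Finset.card_univ] at *
    omega
  have hab : a ≠ b := by
    rcases l with _ | ⟨z, _ | ⟨z', l⟩⟩ <;> grind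
  -- Reversing the final segment of the path closes it up to a cycle.
  have hcross : ∀ l₁ l₂ x y, l = l₁ ++ l₂ → x ∈ l₁.getLast? → y ∈ l₂.head? →
      G.Adj x b → ¬ G.Adj y a := by
    rintro l₁ l₂ x y rfl hx hy hxb hya
    have hp : (l₁ ++ l₂.reverse).Perm (l₁ ++ l₂) := (List.reverse_perm _).append_left _
    refine hG (.of_isChain (l := l₁ ++ l₂.reverse) (x := y) (y := a) hn ?_ (hp.nodup_iff.2 hd)
      (fun v => hp.mem_iff.2 (hall v)) ?_ ?_ hya)
    · rw [List.isChain_append] at hc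
      refine hc.1.append_of_mem (List.isChain_reverse.2 (hc.2.1.imp fun _ _ h => h.symm)) hx
        (y := b) ?_ hxb
      rw [List.head?_reverse]
      rcases l₂ with _ | ⟨z, l₂⟩
      · simp at hy
      · simpa using hb
    · exact List.mem_getLast?_append_of_mem_getLast? (by simpa using hy)
    · rcases l₁ with _ | ⟨z, l₁⟩
      · simp at hx
      · simpa using ha
  obtain ⟨A, c, B, rfl, hcb, hA⟩ :
      ∃ A c B, l = A ++ c :: B ∧ G.Adj c b ∧ ∀ z ∈ A, ¬ G.Adj z b := by
    refine List.exists_eq_append_cons_of_first ?_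
    obtain ⟨l', rfl⟩ := List.getLast?_eq_some_iff.1 hb
    have hl' : l' ≠ [] := by rintro rfl; simp at hlen
    rw [List.isChain_append] at hc
    exact ⟨l'.getLast hl', by simp,
      hc.2.2 _ (by rw [List.getLast?_eq_some_getLast hl']; simp) b (by simp)⟩
  have hAne : a ∈ A := by
    rcases A with _ | ⟨z, A⟩
    · simp at ha; subst ha; exact absurd hcb.symm hba
    · simp at ha; simp [ha]
  have hBne : b ∈ B := by
    rcases List.eq_nil_or_concat B with rfl | ⟨B', z, rfl⟩
    · simp at hb; subst hb; simp at hcb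
    · simp [List.getLast?_append, List.getLast?_cons] at hb
      simp [hb]
  have hB : ∀ B₁ z B₂, B = B₁ ++ z :: B₂ → ¬ G.Adj z a := by
    intro B₁
    induction B₁ using List.reverseRecOn with
    | nil =>
      rintro z B₂ rfl
      exact hcross (A ++ [c]) (z :: B₂) c z (by simp) (by simp) (by simp) hcb
    | append_singleton B₁ u ih =>
      rintro z B₂ rfl
      have hu := ih u (z :: B₂) (by simp)
      refine hcross ((A ++ c :: B₁) ++ [u]) (z :: B₂) u z (by simp)
        (by simp [List.getLast?_cons]) (by simp) ?_
      have hbz : b ∈ z :: B₂ := by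
        apply List.mem_of_getLast?
        simpa [List.getLast?_append, List.getLast?_cons] using hb
      have hub : u ≠ b := by grind
      have hua : u ≠ a := by grind
      have := hind u a b hua hab hub
      rw [G.adj_comm a b] at this
      tauto
  have hB' : ∀ z ∈ B, ¬ G.Adj z a := by
    intro z hz
    obtain ⟨B₁, B₂, h⟩ := List.append_of_mem hz
    exact hB B₁ z B₂ h
  have hdis : ∀ z ∈ A, z ∉ c :: B := (List.nodup_append'.1 hd).2.2
  have hcB : c ∉ B := by grind
  have hAcl : ∀ u ∈ A, ∀ v ∈ A, u ≠ v → G.Adj u v := by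
    intro u hu v hv huv
    have := hind u v b huv (by grind) (by grind)
    grind
  have hBcl : ∀ u ∈ B, ∀ v ∈ B, u ≠ v → G.Adj u v := by
    intro u hu v hv huv
    have := hind u v a huv (by grind) (by grind)
    grind
  obtain ⟨i, hi, j, hj, hic, hjc, hij⟩ := (hconn c).exists_adj_boundary_of_induce_compl
    {z | z ∈ A} (x := a) (y := b) (by grind) (by grind) hAne (by grind)
  have hjB : j ∈ B := by have := hall j; grind
  have hia : i ≠ a := by rintro rfl; exact hB' j hjB hij.symm
  have hjb : j ≠ b := by rintro rfl; exact hA i hi hij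
  by_cases hca : G.Adj c a
  · exact hG (.of_two_cliques_of_vertex hn hAcl hBcl hd hall hAne hi hBne hjB hia.symm hjb.symm
      hca hij hcb.symm)
  have hcBcl : ∀ u ∈ c :: B, ∀ v ∈ c :: B, u ≠ v → G.Adj u v := by
    intro u hu v hv huv
    have := hind u v a huv (by grind) (by grind)
    grind
  obtain ⟨d, hdl⟩ : ∃ d, d ∈ A.getLast? := by
    rw [List.getLast?_eq_some_getLast (List.ne_nil_of_mem hAne)]; simp
  have hdA : d ∈ A := List.mem_of_getLast? hdl
  have hdc : G.Adj d c := by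
    rw [List.isChain_append] at hc
    exact hc.2.2 d hdl c (by simp)
  have hkey : ∀ i' ∈ A, ∀ j' ∈ c :: B, G.Adj i' j' → i' ≠ d → j' = c := by
    intro i' hi' j' hj' hadj hne
    by_contra hjc'
    exact hG (.of_two_cliques hn hAcl hcBcl hd hall hi' hdA hj' List.mem_cons_self hne hjc'
      hadj hdc)
  have hid : i = d := by
    by_contra h
    exact hjc (hkey i hi j (by simp [hjB]) hij h)
  subst hid
  obtain ⟨i', hi', j', hj', hid', -, hij'⟩ := (hconn i).exists_adj_boundary_of_induce_compl
    {z | z ∈ A} (x := a) (y := c) hia.symm hic.symm hAne (by grind)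
  have hjB' : j' ∈ c :: B := by have := hall j'; grind
  have hjc' := hkey i' hi' j' hjB' hij' hid'
  subst hjc'
  exact hG (.of_two_cliques hn hAcl hcBcl hd hall hi' hdA hjB' (by simp [hjB]) hid' hjc.symm
    hij' hij)

end SimpleGraph

/-- Every 2-connected `(K1 ∪ K1 ∪ K1)`-free graph on `n ≥ 3` vertices is hamiltonian.
Here 2-connected means: at least 3 vertices, and the graph remains connected after the
deletion of any single vertex. -/
theorem stmt_2 {V : Type} [Fintype V] [DecidableEq V] (G : SimpleGraph V)
    (hn : 3 ≤ Fintype.card V)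
    (h2conn : ∀ v : V, (G.induce ({v}ᶜ : Set V)).Connected)
    (hfree : InducedFree K1K1K1 G) :
    G.IsHamiltonian := by
  refine SimpleGraph.isHamiltonian_of_no_independent_triple hn h2conn ?_
  intro x y z hxy hyz hxz
  by_contra! h
  obtain ⟨h1, h2, h3⟩ := h
  refine hfree ⟨⟨⟨![x, y, z], ?_⟩, ?_⟩⟩
  · intro i j hij
    fin_cases i <;> fin_cases j <;> simp_all
  · intro i j
    change G.Adj (![x, y, z] i) (![x, y, z] j) ↔ False
    fin_cases i <;> fin_cases j <;> simp [h1, h2, h3, G.adj_comm y x, G.adj_comm z]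
end

section
/- Every (K1 ∪ P2)-free graph G on n ≥ 3 vertices either is hamiltonian, or G belongs to the class ℵ and the independence number of G satisfies α(G) > n/2. -/
/-- `K1 ∪ P2`: a vertex `0` together with an edge `{1, 2}`, the vertex `0` being
nonadjacent to both endpoints of the edge. -/
def K1P2 : SimpleGraph (Fin 3) := SimpleGraph.fromEdgeSet {s(1, 2)}

/-- The class `ℵ`: a graph `G` belongs to `ℵ` iff either its vertex set is independent,
or it is complete, or its vertex set has a partition `V = V1 ∪ V2` into disjoint
nonempty sets such that `V1` is independent, `N(v) = V2` for every `v ∈ V1`, and the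
induced subgraph `G[V2]` belongs to `ℵ`. -/
inductive Aleph : ∀ {V : Type}, SimpleGraph V → Prop
  | indep {V : Type} (G : SimpleGraph V) (h : ∀ u v : V, ¬ G.Adj u v) : Aleph G
  | complete {V : Type} (G : SimpleGraph V) (h : ∀ u v : V, u ≠ v → G.Adj u v) : Aleph G
  | split {V : Type} (G : SimpleGraph V) (V1 V2 : Set V)
      (h1 : V1.Nonempty) (h2 : V2.Nonempty) (hdisj : Disjoint V1 V2)
      (hunion : V1 ∪ V2 = Set.univ)
      (hindep : ∀ u ∈ V1, ∀ v ∈ V1, ¬ G.Adj u v)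
      (hnbhd : ∀ v ∈ V1, G.neighborSet v = V2)
      (hrec : Aleph (G.induce V2)) : Aleph G

/-- The independence number `α(G)` of a finite graph: the maximum size of a set of
pairwise nonadjacent vertices. -/
noncomputable def indepNum {V : Type} [Fintype V] (G : SimpleGraph V) : ℕ :=
  sSup {k : ℕ | ∃ s : Finset V, (∀ u ∈ s, ∀ v ∈ s, ¬ G.Adj u v) ∧ s.card = k}

theorem InducedFree.isCompleteMultipartite {V : Type*} {G : SimpleGraph V}
    (hfree : InducedFree K1P2 G) : G.IsCompleteMultipartite := by
  by_contra hG
  obtain ⟨v, w₁, w₂, h⟩ :=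
    SimpleGraph.exists_isPathGraph3Compl_of_not_isCompleteMultipartite hG
  refine hfree ⟨⟨⟨![v, w₁, w₂], ?_⟩, ?_⟩⟩
  · intro i j hij
    fin_cases i <;> fin_cases j <;>
      simp_all [h.ne_fst, h.ne_snd, h.fst_ne_snd, h.ne_fst.symm, h.ne_snd.symm,
        h.fst_ne_snd.symm]
  · intro i j
    change G.Adj (![v, w₁, w₂] i) (![v, w₁, w₂] j) ↔ _
    fin_cases i <;> fin_cases j <;>
      simp [K1P2, h.adj, h.adj.symm, h.not_adj_fst, h.not_adj_snd, G.adj_comm _ v]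

theorem le_indepNum {V : Type} [Fintype V] {G : SimpleGraph V} {s : Finset V}
    (hs : ∀ u ∈ s, ∀ v ∈ s, ¬ G.Adj u v) : s.card ≤ indepNum G := by
  refine le_csSup ⟨Fintype.card V, ?_⟩ ⟨s, hs, rfl⟩
  rintro k ⟨t, -, rfl⟩
  exact t.card_le_univ

namespace SimpleGraph

theorem isHamiltonian_of_injective {V : Type*} [Fintype V] [DecidableEq V] {G : SimpleGraph V}
    {n : ℕ} (hn : 3 ≤ n) (hcard : Fintype.card V = n) (f : Fin n → V)
    (hf : Function.Injective f)
    (hstep : ∀ (i : ℕ) (hi : i + 1 < n), G.Adj (f ⟨i, by lia⟩) (f ⟨i + 1, hi⟩))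
    (hclose : G.Adj (f ⟨n - 1, by lia⟩) (f ⟨0, by lia⟩)) : G.IsHamiltonian := by
  have key : ∀ u v : Fin n, (u - v).val = 1 → G.Adj (f v) (f u) := by
    rintro ⟨x, hx⟩ ⟨y, hy⟩ h
    rcases le_or_gt y x with hle | hlt
    · rw [Fin.sub_val_of_le hle] at h
      obtain rfl : x = y + 1 := by simp at h; lia
      exact hstep y hx
    · rw [Fin.coe_sub_iff_lt.mpr hlt] at h
      obtain rfl : x = 0 := by simp at h; lia
      obtain rfl : y = n - 1 := by simp at h; lia
      exact hclose
  have hcycle : cycleGraph n ⊑ G := by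
    refine ⟨⟨⟨f, fun {u v} huv => ?_⟩, hf⟩⟩
    rcases cycleGraph_adj'.mp huv with h | h
    · exact (key _ _ h).symm
    · exact key _ _ h
  obtain ⟨v, p, hp, hlen⟩ := (cycleGraph_isContained_iff (by lia)).mp hcycle
  exact fun _ => ⟨v, p,
    Walk.isHamiltonianCycle_iff_isCycle_and_length_eq.mpr ⟨hp, by rw [hlen, hcard]⟩⟩

namespace IsCompleteMultipartite

theorem not_adj_trans {V : Type*} {G : SimpleGraph V} (hG : G.IsCompleteMultipartite)
    {u v w : V} (huv : ¬ G.Adj u v) (hvw : ¬ G.Adj v w) : ¬ G.Adj u w :=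
  hG.trans u v w huv hvw

theorem aleph {V : Type} [Finite V] {G : SimpleGraph V} (hG : G.IsCompleteMultipartite) :
    Aleph G := by
  induction hn : Nat.card V using Nat.strong_induction_on generalizing V with
  | _ n ih =>
    by_cases hind : ∀ u v : V, ¬ G.Adj u v
    · exact .indep G hind
    push Not at hind
    obtain ⟨u, w, huw⟩ := hind
    have hcls : ∀ x, ¬ G.Adj u x → ∀ y, G.Adj x y ↔ G.Adj u y := fun x hx y =>
      ⟨fun hxy => by_contra fun h => hG.not_adj_trans (fun e => hx e.symm) h hxy,
        fun huy => by_contra fun h => hG.not_adj_trans hx h huy⟩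
    refine .split G {x | ¬ G.Adj u x} (G.neighborSet u) ⟨u, G.irrefl⟩ ⟨w, huw⟩ ?_ ?_ ?_ ?_ ?_
    · exact Set.disjoint_left.mpr fun x hx hx' => hx hx'
    · ext x
      simp [em']
    · exact fun x hx y hy hxy => hy ((hcls x hx y).mp hxy)
    · exact fun x hx => Set.ext fun y => hcls x hx y
    · refine ih _ ?_ hG.induce rfl
      rw [← hn]
      exact Finite.card_subtype_lt (p := (· ∈ G.neighborSet u)) (x := u) G.irrefl

/-- The vertices can be listed so that each part is an interval and a given part comes first. -/
theorem exists_equiv_fin {V : Type*} [Fintype V] {G : SimpleGraph V}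
    (hG : G.IsCompleteMultipartite) (v₀ : V) :
    ∃ e : Fin (Fintype.card V) ≃ V,
      (∀ i j k, i ≤ j → j ≤ k → ¬ G.Adj (e i) (e k) → ¬ G.Adj (e i) (e j)) ∧
      ∀ i, i.val = 0 → ¬ G.Adj v₀ (e i) := by
  classical
  let q := Fintype.equivFin (Quotient hG.setoid)
  let key : V → ℕ := fun v => if ¬ G.Adj v₀ v then 0 else (q (Quotient.mk hG.setoid v)).val + 1
  have hzero : ∀ v, key v = 0 ↔ ¬ G.Adj v₀ v := fun v => by
    by_cases h : G.Adj v₀ v <;> simp [key, h]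
  have hq : ∀ u v, q (Quotient.mk hG.setoid u) = q (Quotient.mk hG.setoid v) ↔ ¬ G.Adj u v :=
    fun u v => q.injective.eq_iff.trans Quotient.eq
  have hkey : ∀ u v, key u = key v ↔ ¬ G.Adj u v := fun u v => by
    by_cases hu : G.Adj v₀ u
    · by_cases hv : G.Adj v₀ v
      · simp [key, hu, hv, ← hq u v, Fin.ext_iff, -EmbeddingLike.apply_eq_iff_eq]
      · have : G.Adj u v := by_contra fun h => hG.not_adj_trans hv (fun e => h e.symm) hu
        simp [key, hu, hv, this]
    · by_cases hv : G.Adj v₀ v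
      · have : G.Adj u v := by_contra fun h => hG.not_adj_trans hu h hv
        simp [key, hu, hv, this]
      · have : ¬ G.Adj u v := hG.not_adj_trans (fun e => hu e.symm) hv
        simp [key, hu, hv, this]
  let e₀ := (Fintype.equivFin V).symm
  let g : Fin (Fintype.card V) → ℕ := key ∘ e₀
  have hmono : Monotone (g ∘ Tuple.sort g) := Tuple.monotone_sort g
  refine ⟨(Tuple.sort g).trans e₀, fun i j k hij hjk hik => ?_, fun i hi => ?_⟩
  · rw [← hkey] at hik ⊢
    have h₁ := hmono hij
    have h₂ := hmono hjk
    exact le_antisymm h₁ (h₂.trans hik.ge)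
  · rw [← hzero]
    have hle : i ≤ ((Tuple.sort g).trans e₀).symm v₀ := by
      rw [Fin.le_def, hi]
      exact Nat.zero_le _
    have h := hmono hle
    have hv₀ : g (Tuple.sort g (((Tuple.sort g).trans e₀).symm v₀)) = 0 := by
      simp [g, hzero]
    exact Nat.le_zero.mp (h.trans hv₀.le)

theorem isHamiltonian {V : Type*} [Fintype V] [DecidableEq V] {G : SimpleGraph V}
    [DecidableRel G.Adj] (hG : G.IsCompleteMultipartite) (hn : 3 ≤ Fintype.card V)
    (hsmall : ∀ u, 2 * (Finset.univ.filter fun v => ¬ G.Adj u v).card ≤ Fintype.card V) :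
    G.IsHamiltonian := by
  have : Nonempty V := Fintype.card_pos_iff.mp (by lia)
  obtain ⟨v₀, hv₀⟩ := Finite.exists_max fun u => (Finset.univ.filter fun v => ¬ G.Adj u v).card
  obtain ⟨e, hconvex, hfirst⟩ := hG.exists_equiv_fin v₀
  generalize hcard : Fintype.card V = n at *
  have hlen : ∀ i j : Fin n, ¬ G.Adj (e i) (e j) → i ≤ j →
      j.val + 1 - i.val ≤ (Finset.univ.filter fun v => ¬ G.Adj (e i) v).card := by
    intro i j hij hle
    rw [← Fin.card_Icc, ← Finset.card_map e.toEmbedding]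
    refine Finset.card_le_card fun v hv => ?_
    obtain ⟨k, hk, rfl⟩ := Finset.mem_map.mp hv
    rw [Finset.mem_Icc] at hk
    simpa using hconvex i k j hk.1 hk.2 hij
  have hfar : ∀ i j : Fin n, n < 2 * (j.val + 1 - i.val) → G.Adj (e i) (e j) := by
    intro i j hij
    by_contra h
    have h₁ := hlen i j h (by rw [Fin.le_def]; lia)
    have h₂ := hsmall (e i)
    lia
  have hhalf : ∀ i j : Fin n, 0 < i.val → 2 * i.val < n → n ≤ 2 * (j.val + 1 - i.val) →
      G.Adj (e i) (e j) := by
    intro i j hi hi' hij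
    by_contra h
    have hle : i ≤ j := by rw [Fin.le_def]; lia
    have h₁ := hlen i j h hle
    let z : Fin n := ⟨0, by lia⟩
    have hz : ¬ G.Adj v₀ (e z) := hfirst z rfl
    have hzi : G.Adj (e z) (e i) := by
      by_contra hzi
      exact hG.not_adj_trans hzi h (hfar z j (by simp only [z]; lia))
    have h₂ : (Finset.univ.filter fun v => ¬ G.Adj v₀ v).card ≤ i.val := by
      rw [← Fin.card_Iio, ← Finset.card_map e.toEmbedding]
      refine Finset.card_le_card fun v hv => ?_
      obtain ⟨k, rfl⟩ := e.surjective v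
      refine Finset.mem_map.mpr ⟨k, ?_, rfl⟩
      rw [Finset.mem_Iio]
      by_contra hk
      exact hconvex z i k (Nat.zero_le _) (not_lt.mp hk)
        (hG.not_adj_trans (fun e => hz e.symm) (Finset.mem_filter.mp hv).2) hzi
    have h₃ := hv₀ (e i)
    lia
  let σ : Fin n → Fin n := fun i =>
    ⟨if i.val % 2 = 0 then i.val / 2 else (n + 1) / 2 + i.val / 2, by split_ifs <;> lia⟩
  have hσ : Function.Injective σ := by
    intro i j hij
    simp only [σ, Fin.mk.injEq] at hij
    ext
    split_ifs at hij <;> lia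
  refine isHamiltonian_of_injective hn hcard (e ∘ σ) (e.injective.comp hσ) (fun i hi => ?_) ?_
  · rcases Nat.mod_two_eq_zero_or_one i with h | h
    · apply hfar
      simp only [σ, h, show (i + 1) % 2 ≠ 0 by lia, if_true, if_false]
      lia
    · symm
      apply hhalf <;>
        simp only [σ, show i % 2 ≠ 0 by lia, show (i + 1) % 2 = 0 by lia, if_true, if_false] <;>
        lia
  · symm
    apply hfar
    simp only [σ, Nat.zero_mod, if_true]
    split_ifs <;> lia

end IsCompleteMultipartite

end SimpleGraph

/-- Every `(K1 ∪ P2)`-free graph `G` on `n ≥ 3` vertices either is hamiltonian,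
or `G` belongs to the class `ℵ` and `α(G) > n / 2`. -/
theorem stmt_3 {V : Type} [Fintype V] [DecidableEq V] (G : SimpleGraph V)
    (hn : 3 ≤ Fintype.card V) (hfree : InducedFree K1P2 G) :
    G.IsHamiltonian ∨ (Aleph G ∧ Fintype.card V < 2 * indepNum G) := by
  classical
  have hG := hfree.isCompleteMultipartite
  refine or_iff_not_imp_left.mpr fun hham => ⟨hG.aleph, ?_⟩
  have hbig : ∃ u, Fintype.card V < 2 * (Finset.univ.filter fun v => ¬ G.Adj u v).card := by
    by_contra! h
    exact hham (hG.isHamiltonian hn h)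
  obtain ⟨u, hu⟩ := hbig
  have hle := le_indepNum (G := G) (s := Finset.univ.filter fun v => ¬ G.Adj u v)
    fun x hx y hy => hG.not_adj_trans (fun e => (Finset.mem_filter.mp hx).2 e.symm)
      (Finset.mem_filter.mp hy).2
  lia
end

section
/- Every (K1 ∪ P2)-free graph G on n ≥ 3 vertices either is hamiltonian or its independence number satisfies α(G) > n/2. -/
open Finset in
/-- The independence number bounds the size of every independent set. -/
theorem card_le_indepNum {V : Type} [Fintype V] (G : SimpleGraph V) (s : Finset V)
    (hs : ∀ u ∈ s, ∀ v ∈ s, ¬ G.Adj u v) : #s ≤ indepNum G :=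
  le_csSup ⟨Fintype.card V, by rintro k ⟨t, -, rfl⟩; exact t.card_le_univ⟩ ⟨s, hs, rfl⟩

/-- A cyclic enumeration of the vertices with consecutive vertices adjacent gives a Hamiltonian
cycle. -/
theorem SimpleGraph.isHamiltonian_of_cyclic_enumeration {V : Type*} [Fintype V] [DecidableEq V]
    {G : SimpleGraph V} {n : ℕ} (hn : 3 ≤ n) (hcard : Fintype.card V = n) (f : Fin n → V)
    (hf : Function.Injective f)
    (hstep : ∀ i j : Fin n, (i : ℕ) + 1 = j → G.Adj (f i) (f j))
    (hclose : ∀ i j : Fin n, (i : ℕ) + 1 = n → (j : ℕ) = 0 → G.Adj (f i) (f j)) :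
    G.IsHamiltonian := by
  have key : ∀ i j : Fin n, (i - j).val = 1 → G.Adj (f j) (f i) := by
    intro i j hij
    rcases le_or_gt j i with h | h
    · rw [Fin.sub_val_of_le h] at hij
      exact hstep j i (by omega)
    · rw [Fin.coe_sub_iff_lt.mpr h] at hij
      exact hclose j i (by omega) (by omega)
  have hcont : (SimpleGraph.cycleGraph n).IsContained G := by
    refine ⟨⟨⟨f, ?_⟩, hf⟩⟩
    intro i j hij
    rcases SimpleGraph.cycleGraph_adj'.mp hij with h | h
    · exact (key i j h).symm
    · exact key j i h
  obtain ⟨v, p, hp, hlen⟩ := (SimpleGraph.cycleGraph_isContained_iff hn).mp hcont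
  exact fun _ => ⟨v, p, SimpleGraph.Walk.isHamiltonianCycle_iff_isCycle_and_length_eq.mpr
    ⟨hp, hlen.trans hcard.symm⟩⟩

/-- The parts of a complete multipartite graph can be labelled by natural numbers, with the part of
a given vertex receiving the label `0`. -/
theorem SimpleGraph.IsCompleteMultipartite.exists_label {V : Type*} [Finite V]
    {G : SimpleGraph V} (h : G.IsCompleteMultipartite) (v₀ : V) :
    ∃ c : V → ℕ, c v₀ = 0 ∧ ∀ u v, c u = c v ↔ ¬ G.Adj u v := by
  classical
  let q : V → Quotient h.setoid := fun v => ⟦v⟧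
  obtain ⟨m, ⟨e⟩⟩ := Finite.exists_equiv_fin (Quotient h.setoid)
  refine ⟨fun v => if q v = q v₀ then 0 else e (q v) + 1, by simp, fun u v => ?_⟩
  have huv : q u = q v ↔ ¬ G.Adj u v := Quotient.eq
  rw [← huv]
  have hinj : (e (q u) : ℕ) = e (q v) ↔ q u = q v := by
    rw [← Fin.ext_iff, e.apply_eq_iff_eq]
  grind

open Finset in
/-- The vertices of a complete multipartite graph can be enumerated part by part, starting with a
part `s` of maximum size. -/
theorem SimpleGraph.IsCompleteMultipartite.exists_enumeration {V : Type*} [Fintype V] [Nonempty V]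
    {G : SimpleGraph V} (h : G.IsCompleteMultipartite) {n : ℕ} (hcard : Fintype.card V = n) :
    ∃ (e : Fin n ≃ V) (s : Finset V), (∀ u ∈ s, ∀ v ∈ s, ¬ G.Adj u v) ∧
      ∀ i j : Fin n, i < j → ¬ G.Adj (e i) (e j) →
        (j : ℕ) + 1 ≤ #s ∨ (j : ℕ) + 1 ≤ #s + i ∧ #s ≤ i := by
  classical
  obtain ⟨v₀, hv₀⟩ := Finite.exists_max fun v : V => #{u | ¬ G.Adj v u}
  obtain ⟨c, hc₀, hc⟩ := h.exists_label v₀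
  have e₀ : Fin n ≃ V := (Fintype.equivFinOfCardEq hcard).symm
  let e : Fin n ≃ V := (Tuple.sort (c ∘ e₀)).trans e₀
  have hmono : Monotone (c ∘ e) := Tuple.monotone_sort (c ∘ e₀)
  refine ⟨e, ({u | ¬ G.Adj v₀ u} : Finset V), ?_, fun i j hij hadj => ?_⟩
  · intro u hu v hv
    simp only [mem_filter_univ, ← hc] at hu hv ⊢
    exact hu.symm.trans hv
  have heq : c (e i) = c (e j) := (hc _ _).mpr hadj
  by_cases h0 : c (e j) = 0
  · left
    rw [← Fin.card_Iic j, ← card_map e.toEmbedding]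
    refine card_le_card fun u hu => ?_
    obtain ⟨k, hk, rfl⟩ := mem_map.mp hu
    have := hmono (mem_Iic.mp hk)
    simp only [mem_filter_univ, ← hc, hc₀]
    simp only [Function.comp_apply] at this
    exact (Nat.le_zero.mp (h0 ▸ this)).symm
  · right
    constructor
    · have hle : #(Icc i j) ≤ #{u | ¬ G.Adj (e i) u} := by
        rw [← card_map e.toEmbedding]
        refine card_le_card fun u hu => ?_
        obtain ⟨k, hk, rfl⟩ := mem_map.mp hu
        have h₁ := hmono (mem_Icc.mp hk).1
        have h₂ := hmono (mem_Icc.mp hk).2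
        simp only [mem_filter_univ, ← hc]
        simp only [Function.comp_apply] at h₁ h₂
        exact le_antisymm h₁ (heq ▸ h₂)
      rw [Fin.card_Icc] at hle
      have := hv₀ (e i)
      omega
    · rw [← Fin.card_Iio i, ← card_map e.toEmbedding]
      refine card_le_card fun u hu => ?_
      simp only [mem_filter_univ, ← hc, hc₀] at hu
      refine mem_map.mpr ⟨e.symm u, mem_Iio.mpr ?_, e.apply_symm_apply u⟩
      by_contra! hle
      have := hmono hle
      simp only [Function.comp_apply, Equiv.apply_symm_apply] at this
      omega

/-- Every `(K1 ∪ P2)`-free graph `G` on `n ≥ 3` vertices either is hamiltonian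
or its independence number satisfies `α(G) > n / 2`. -/
theorem stmt_4 {V : Type} [Fintype V] [DecidableEq V] (G : SimpleGraph V)
    (hn : 3 ≤ Fintype.card V) (hfree : InducedFree K1P2 G) :
    G.IsHamiltonian ∨ Fintype.card V < 2 * indepNum G := by
  by_contra! hcon
  obtain ⟨hham, hα⟩ := hcon
  have : Nonempty V := Fintype.card_pos_iff.mp (by omega)
  obtain ⟨n, hcard⟩ : ∃ n, Fintype.card V = n := ⟨_, rfl⟩
  obtain ⟨e, s, hs, hadj⟩ := hfree.isCompleteMultipartite.exists_enumeration hcard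
  have hsα := card_le_indepNum G s hs
  rw [hcard] at hn hα
  have hfar : ∀ i j : Fin n, i < j → s.card < (j : ℕ) + 1 →
      ((j : ℕ) + 1 ≤ s.card + i → (i : ℕ) < s.card) → G.Adj (e i) (e j) := by
    intro i j hij h₁ h₂
    by_contra h
    have := hadj i j hij h
    omega
  -- Interleave the two halves of the enumeration.
  let g : Fin n → Fin n := fun k =>
    ⟨if (k : ℕ) % 2 = 0 then k / 2 else k / 2 + (n + 1) / 2, by split_ifs <;> omega⟩
  have hg : ∀ k, (g k : ℕ) = if (k : ℕ) % 2 = 0 then (k : ℕ) / 2 else k / 2 + (n + 1) / 2 :=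
    fun _ => rfl
  refine hham (SimpleGraph.isHamiltonian_of_cyclic_enumeration hn hcard (e ∘ g)
    (e.injective.comp fun a b hab => ?_) (fun i j hij => ?_) fun i j hi hj => ?_)
  · have h := congrArg Fin.val hab
    rw [hg, hg] at h
    ext
    split_ifs at h <;> omega
  · have hi := hg i
    have hj := hg j
    by_cases hpar : (i : ℕ) % 2 = 0
    · rw [if_pos hpar] at hi
      rw [if_neg (by omega)] at hj
      exact hfar _ _ (Fin.lt_def.mpr (by omega)) (by omega) (by omega)
    · rw [if_neg hpar] at hi
      rw [if_pos (by omega)] at hj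
      exact (hfar _ _ (Fin.lt_def.mpr (by omega)) (by omega) (by omega)).symm
  · have hi' := hg i
    have hj' := hg j
    rw [if_pos (by omega)] at hj'
    split_ifs at hi' <;>
      exact (hfar _ _ (Fin.lt_def.mpr (by omega)) (by omega) (by omega)).symm
end

section
/- Every 1-tough (K1 ∪ P3)-free graph on n ≥ 3 vertices is hamiltonian. -/
/-- `K1 ∪ P3`: a vertex `0` together with an induced path `1 - 2 - 3` on three vertices,
the vertex `0` being nonadjacent to all vertices of the path. -/
def K1P3 : SimpleGraph (Fin 4) := SimpleGraph.fromEdgeSet {s(1, 2), s(2, 3)}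

/-- The number of connected components of the graph obtained from `G` by deleting
the vertices of `S`. -/
noncomputable def numCompDel {V : Type} [Fintype V] (G : SimpleGraph V) (S : Finset V) : ℕ :=
  Nat.card (G.induce ((↑S : Set V)ᶜ)).ConnectedComponent

/-- A finite graph is 1-tough if for every vertex subset `S` whose deletion disconnects
the graph (i.e. leaves at least two connected components), `|S|` is at least the number
of connected components of `G − S`. -/
def OneTough {V : Type} [Fintype V] (G : SimpleGraph V) : Prop :=
  ∀ S : Finset V, 2 ≤ numCompDel G S → numCompDel G S ≤ S.card

open SimpleGraph

section ClosedLists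

variable {V : Type*}

/-- A list of at least three distinct vertices, cyclically consecutive ones being adjacent. -/
def IsCycleList (G : SimpleGraph V) (l : List V) : Prop :=
  l.Nodup ∧ 3 ≤ l.length ∧ Cycle.Chain G.Adj (l : Cycle V)

lemma cycleChain_coe_iff {r : V → V → Prop} {l : List V} (hl : l ≠ []) :
    Cycle.Chain r (l : Cycle V) ↔ l.IsChain r ∧ r (l.getLast hl) (l.head hl) := by
  cases l with
  | nil => exact absurd rfl hl
  | cons a t =>
    rw [Cycle.chain_coe_cons, ← List.cons_append, List.isChain_append]
    simp [List.getLast?_cons, List.getLast_eq_getLastD]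

lemma cycleChain_append_iff {r : V → V → Prop} {l₁ l₂ : List V} (h₁ : l₁ ≠ []) (h₂ : l₂ ≠ []) :
    Cycle.Chain r (l₁ ++ l₂ : List V) ↔ l₁.IsChain r ∧ l₂.IsChain r ∧
      r (l₁.getLast h₁) (l₂.head h₂) ∧ r (l₂.getLast h₂) (l₁.head h₁) := by
  rw [cycleChain_coe_iff (by simp [h₁]), List.isChain_append]
  simp [h₁, h₂, List.getLast?_eq_getLast_of_ne_nil, List.head?_eq_some_head, and_assoc]

lemma IsCycleList.of_isRotated {G : SimpleGraph V} {l l' : List V} (h : IsCycleList G l)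
    (hr : l ~r l') : IsCycleList G l' :=
  ⟨hr.nodup_iff.1 h.1, hr.perm.length_eq ▸ h.2.1, Cycle.coe_eq_coe.2 hr ▸ h.2.2⟩

lemma SimpleGraph.Walk.IsCycle.exists_isCycleList {G : SimpleGraph V} {u : V} {c : G.Walk u u}
    (hc : c.IsCycle) : ∃ l, IsCycleList G l := by
  cases c with
  | nil => exact absurd hc (by simp)
  | cons h p =>
    have h3 := hc.three_le_length
    rw [Walk.cons_isCycle_iff] at hc
    refine ⟨p.support, hc.1.support_nodup, by simpa using h3, ?_⟩
    rw [cycleChain_coe_iff p.support_ne_nil]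
    exact ⟨p.isChain_adj_support, by simpa using h⟩

lemma IsCycleList.isHamiltonian [Fintype V] [DecidableEq V] {G : SimpleGraph V} {l : List V}
    (hl : IsCycleList G l) (hmem : ∀ v, v ∈ l) : G.IsHamiltonian := by
  intro _
  obtain ⟨hnd, h3, hch⟩ := hl
  have hne : l ≠ [] := by rintro rfl; simp at h3
  rw [cycleChain_coe_iff hne] at hch
  have hcard : l.length = Fintype.card V := by
    rw [← List.toFinset_card_of_nodup hnd, ← Finset.card_univ]
    congr 1
    ext v
    simp [hmem v]
  refine ⟨_, Walk.cons hch.2 (Walk.ofSupport l hne hch.1), ?_⟩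
  rw [Walk.isHamiltonianCycle_iff_isCycle_and_length_eq,
    Walk.isCycle_iff_isPath_tail_and_le_length]
  have hlen : (Walk.cons hch.2 (Walk.ofSupport l hne hch.1)).length = l.length := by
    rw [Walk.length_cons, Walk.length_ofSupport]
    lia
  refine ⟨⟨?_, hlen ▸ h3⟩, hlen.trans hcard⟩
  simp [Walk.isPath_def, hnd]

/-- A cyclic list can be rotated so that a given element comes last; the head is then the
image of that element under the cyclic permutation of the list. -/
lemma exists_isRotated_getLast [DecidableEq V] {l : List V} (hl : l.Nodup) {x : V} (hx : x ∈ l) :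
    ∃ (l' : List V) (hne : l' ≠ []), l ~r l' ∧ l'.getLast hne = x ∧
      l'.head hne = l.formPerm x := by
  obtain ⟨s, t, rfl⟩ := List.append_of_mem hx
  have hr : (s ++ x :: t) ~r (t ++ (s ++ [x])) := by
    have := List.isRotated_append (l := s ++ [x]) (l' := t)
    simpa using this
  refine ⟨t ++ (s ++ [x]), by simp, hr, by simp, ?_⟩
  rw [List.formPerm_eq_of_isRotated hl hr]
  obtain ⟨a, m, hm⟩ := List.exists_cons_of_ne_nil (show t ++ (s ++ [x]) ≠ [] by simp)
  have hx' : (a :: m).getLast (by simp) = x := by simp [← hm]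
  have := List.formPerm_apply_getLast a m
  rw [hx'] at this
  simp only [hm, List.head_cons, this]

variable [DecidableEq V] {G : SimpleGraph V} {l w : List V}

/-- A path outside a longest cycle cannot connect a vertex of the cycle to its successor. -/
lemma IsCycleList.not_adj_formPerm (hl : IsCycleList G l)
    (hmax : ∀ l', IsCycleList G l' → l'.length ≤ l.length)
    (hw : w ≠ []) (hwn : w.Nodup) (hwc : w.IsChain G.Adj) (hd : l.Disjoint w) {x : V}
    (hx : x ∈ l) (hxw : G.Adj x (w.head hw)) : ¬ G.Adj (w.getLast hw) (l.formPerm x) := by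
  intro hadj
  obtain ⟨l', hne, hr, hlast, hhead⟩ := exists_isRotated_getLast hl.1 hx
  have hl' := hl.of_isRotated hr
  have hnew : IsCycleList G (l' ++ w) := by
    refine ⟨hl'.1.append hwn fun a ha => hd (hr.perm.mem_iff.2 ha), ?_, ?_⟩
    · have := hl'.2.1
      simp only [List.length_append]
      lia
    · rw [cycleChain_append_iff hne hw, hlast, hhead]
      exact ⟨((cycleChain_coe_iff hne).1 hl'.2.2).1, hwc, hxw, hadj⟩
  have := hmax _ hnew
  rw [List.length_append, ← hr.perm.length_eq] at this
  have := List.length_pos_iff.2 hw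
  lia

/-- If a path outside a longest cycle connects two vertices of the cycle, then the successors
of these vertices are not adjacent. -/
lemma IsCycleList.not_adj_formPerm_formPerm (hl : IsCycleList G l)
    (hmax : ∀ l', IsCycleList G l' → l'.length ≤ l.length)
    (hw : w ≠ []) (hwn : w.Nodup) (hwc : w.IsChain G.Adj) (hd : l.Disjoint w) {x y : V}
    (hx : x ∈ l) (hy : y ∈ l) (hxy : x ≠ y)
    (hxw : G.Adj x (w.head hw)) (hyw : G.Adj (w.getLast hw) y) :
    ¬ G.Adj (l.formPerm x) (l.formPerm y) := by
  intro hadj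
  obtain ⟨l', hne, hr, hlast, hhead⟩ := exists_isRotated_getLast hl.1 hx
  have hl' := hl.of_isRotated hr
  obtain ⟨p, q, rfl⟩ := List.append_of_mem (hr.perm.mem_iff.1 hy)
  have hq : q ≠ [] := by
    rintro rfl
    simp at hlast
    exact hxy hlast.symm
  have hyq : q.head hq = l.formPerm y := by
    obtain ⟨z, q, rfl⟩ := List.exists_cons_of_ne_nil hq
    have hr' : l ~r (z :: (q ++ p ++ [y])) := by
      refine hr.trans ?_
      have := List.isRotated_append (l := p ++ [y]) (l' := z :: q)
      simpa using this
    rw [List.formPerm_eq_of_isRotated hl.1 hr', List.formPerm_cons_concat_apply_last,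
      List.head_cons]
  have hpne : p ++ [y] ≠ [] := by simp
  rw [show p ++ y :: q = (p ++ [y]) ++ q by simp] at hr hl'
  have hc := (cycleChain_append_iff hpne hq).1 hl'.2.2
  have hheadp : (p ++ [y]).head hpne = l.formPerm x := by
    rw [← hhead]
    cases p <;> simp
  have hlastq : q.getLast hq = x := by
    rw [← hlast]
    simp [hq]
  have hnew : IsCycleList G ((p ++ [y]).reverse ++ (q ++ w)) := by
    refine ⟨?_, ?_, ?_⟩
    · have h : ((p ++ [y]) ++ q ++ w).Nodup :=
        hl'.1.append hwn fun a ha => hd (hr.perm.mem_iff.2 ha)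
      refine (List.Perm.nodup_iff ?_).1 h
      rw [List.append_assoc]
      exact (List.reverse_perm _).symm.append_right _
    · have := hl'.2.1
      simp only [List.length_append, List.length_reverse] at this ⊢
      lia
    · rw [cycleChain_append_iff (by simp) (by simp [hq])]
      refine ⟨?_, ?_, ?_, ?_⟩
      · rw [List.isChain_reverse]
        exact hc.1.imp fun _ _ h => h.symm
      · refine hc.2.1.append hwc ?_
        simpa [List.getLast?_eq_getLast_of_ne_nil, List.head?_eq_some_head, hq, hw, hlastq]
          using hxw
      · rw [List.getLast_reverse, hheadp, List.head_append_of_ne_nil hq, hyq]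
        exact hadj
      · rw [List.getLast_append_of_ne_nil _ hw, List.head_reverse]
        simpa using hyw
  have := hmax _ hnew
  rw [hr.perm.length_eq] at this
  have := List.length_pos_iff.2 hw
  simp only [List.length_append, List.length_reverse] at *
  lia

end ClosedLists

section Toughness

variable {V : Type} [Fintype V] {G : SimpleGraph V}

/-- If `A` avoids `S` and some labelling that is constant along the edges of `G - S` separates
the elements of `A`, then `|A| ≤ |S|` in a 1-tough graph. -/
lemma OneTough.card_le {κ : Type*} (h : OneTough G) (S A : Finset V) (g : V → κ)
    (hg : ∀ u v, u ∉ S → v ∉ S → G.Adj u v → g u = g v) (hAS : ∀ a ∈ A, a ∉ S)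
    (hinj : Set.InjOn g A) (hA : 2 ≤ A.card) : A.card ≤ S.card := by
  have key : A.card ≤ numCompDel G S := by
    have hmem : ∀ u : ((↑S : Set V)ᶜ : Set V), (u : V) ∉ S := fun u hu => u.2 hu
    have hreach : ∀ u v : ((↑S : Set V)ᶜ : Set V),
        (G.induce ((↑S : Set V)ᶜ)).Reachable u v → g u = g v := by
      rintro u v ⟨p⟩
      induction p with
      | nil => rfl
      | cons hadj _ ih =>
        exact (hg _ _ (hmem _) (hmem _) hadj).trans ih
    let f : A → (G.induce ((↑S : Set V)ᶜ)).ConnectedComponent := fun a =>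
      (G.induce ((↑S : Set V)ᶜ)).connectedComponentMk ⟨a, by simpa using hAS a a.2⟩
    have hf : Function.Injective f := fun a b hab =>
      Subtype.ext (hinj a.2 b.2 (hreach _ _ (ConnectedComponent.exact hab)))
    have := Nat.card_le_card_of_injective f hf
    simpa [numCompDel] using this
  exact key.trans (h S (hA.trans key))

lemma OneTough.connected (h : OneTough G) (hn : 3 ≤ Fintype.card V) : G.Connected := by
  classical
  have : Nonempty V := Fintype.card_pos_iff.1 (by lia)
  refine ⟨fun u v => ?_⟩
  by_contra huv
  have hne : G.connectedComponentMk u ≠ G.connectedComponentMk v :=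
    fun h' => huv (ConnectedComponent.exact h')
  have huv' : u ≠ v := fun h' => hne (congrArg _ h')
  have hc : ({u, v} : Finset V).card = 2 := Finset.card_pair huv'
  have := h.card_le ∅ {u, v} G.connectedComponentMk
    (fun a b _ _ hab => ConnectedComponent.sound hab.reachable) (by simp)
    (by rw [Finset.coe_pair, Set.injOn_pair]; exact fun h' => absurd h' hne) hc.ge
  simp [hc] at this

lemma OneTough.not_isAcyclic (h : OneTough G) (hn : 3 ≤ Fintype.card V) : ¬ G.IsAcyclic := by
  classical
  intro hac
  have : Nontrivial V := Fintype.one_lt_card_iff_nontrivial.1 (by lia)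
  obtain ⟨v, hv⟩ := IsTree.exists_vert_degree_one_of_nontrivial ⟨h.connected hn, hac⟩
  obtain ⟨w, hw⟩ : ∃ w, w ∉ insert v (G.neighborFinset v) := by
    by_contra! hall
    have := Finset.card_insert_le v (G.neighborFinset v)
    rw [Finset.eq_univ_iff_forall.2 hall, Finset.card_univ, card_neighborFinset_eq_degree] at this
    lia
  simp only [Finset.mem_insert, not_or, mem_neighborFinset] at hw
  have hc : ({v, w} : Finset V).card = 2 := Finset.card_pair (Ne.symm hw.1)
  have := h.card_le (G.neighborFinset v) {v, w} (fun u => u = v)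
    (by
      intro a b ha hb hab
      rw [mem_neighborFinset] at ha hb
      refine propext ⟨?_, ?_⟩
      · rintro rfl; exact absurd hab hb
      · rintro rfl; exact absurd hab.symm ha)
    (by simp [hw.2])
    (by rw [Finset.coe_pair, Set.injOn_pair]; simp [hw.1]) hc.ge
  rw [card_neighborFinset_eq_degree] at this
  lia

end Toughness

lemma InducedFree.not_isolated_path {V : Type*} {G : SimpleGraph V} (h : InducedFree K1P3 G)
    {a b c d : V} (hbc : G.Adj b c) (hcd : G.Adj c d) (hbd : ¬ G.Adj b d) (hbd' : b ≠ d)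
    (hab : ¬ G.Adj a b) (hac : ¬ G.Adj a c) (had : ¬ G.Adj a d)
    (hab' : a ≠ b) (hac' : a ≠ c) (had' : a ≠ d) : False := by
  have hcb := hbc.ne
  have hcd' := hcd.ne
  refine h ⟨⟨⟨![a, b, c, d], ?_⟩, ?_⟩⟩
  · intro i j hij
    fin_cases i <;> fin_cases j <;> simp_all [eq_comm]
  · intro i j
    change G.Adj (![a, b, c, d] i) (![a, b, c, d] j) ↔ K1P3.Adj i j
    fin_cases i <;> fin_cases j <;> simp_all [K1P3, G.adj_comm]

/-- In a 1-tough `(K1 ∪ P3)`-free graph, an independent set with at least three elements has at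
least as many common neighbours as elements. -/
lemma OneTough.card_le_card_commonNeighbors {V : Type} [Fintype V] {G : SimpleGraph V}
    (ht : OneTough G) (hf : InducedFree K1P3 G) {A S : Finset V} (hA : G.IsIndepSet A)
    (h3 : 3 ≤ A.card) (hS : ∀ v, v ∈ S ↔ ∀ a ∈ A, G.Adj v a) : A.card ≤ S.card := by
  classical
  have hind : ∀ a ∈ A, ∀ b ∈ A, ¬ G.Adj a b := fun a ha b hb hab => hA ha hb hab.ne hab
  have hone : ∀ v, v ∉ S → ∀ b ∈ A, ∀ c ∈ A, G.Adj v b → G.Adj v c → b = c := by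
    intro v hv b hb c hc hvb hvc
    by_contra hbc
    rw [hS] at hv
    push Not at hv
    obtain ⟨a, ha, hva⟩ := hv
    refine hf.not_isolated_path hvb.symm hvc (hind b hb c hc) hbc (hind a ha b hb)
      (fun h => hva h.symm) (hind a ha c hc) ?_ ?_ ?_
    · rintro rfl; exact hva hvb
    · rintro rfl; exact hind a ha b hb hvb
    · rintro rfl; exact hva hvc
  have hsub : ∀ u v, u ∉ S → v ∉ S → G.Adj u v →
      ∀ a ∈ A, (u = a ∨ G.Adj u a) → (v = a ∨ G.Adj v a) := by
    rintro u v hu hv huv a ha (rfl | hua)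
    · exact Or.inr huv.symm
    · by_contra! hva
      have huA : u ∉ A := fun h => hind u h a ha hua
      have hvA : v ∉ A := fun h => hva.1 (hone u hu v h a ha huv hua)
      obtain ⟨c, hc, hca, hcv⟩ : ∃ c ∈ A, c ≠ a ∧ ¬ G.Adj v c := by
        by_contra! hall
        have : 1 < (A.erase a).card := by rw [Finset.card_erase_of_mem ha]; lia
        obtain ⟨b, hb, c, hc, hbc⟩ := Finset.one_lt_card.1 this
        rw [Finset.mem_erase] at hb hc
        exact hbc (hone v hv b hb.2 c hc.2 (hall b hb.2 hb.1) (hall c hc.2 hc.1))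
      refine hf.not_isolated_path hua.symm huv (fun h => hva.2 h.symm) (Ne.symm hva.1)
        (hind c hc a ha) (fun h => hca (hone u hu c hc a ha h.symm hua)) (fun h => hcv h.symm)
        hca ?_ ?_
      · rintro rfl; exact huA hc
      · rintro rfl; exact hvA hc
  refine ht.card_le S A (fun v => {a ∈ A | v = a ∨ G.Adj v a}) ?_ ?_ ?_ (by lia)
  · intro u v hu hv huv
    ext a
    simp only [Finset.mem_filter]
    exact and_congr_right fun ha =>
      ⟨hsub u v hu hv huv a ha, hsub v u hv hu huv.symm a ha⟩
  · intro a ha haS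
    exact G.irrefl ((hS a).1 haS a ha)
  · intro a ha b hb hab
    have : a ∈ ({x ∈ A | b = x ∨ G.Adj b x} : Finset V) :=
      (Finset.ext_iff.1 hab a).1 (by simpa using ha)
    rw [Finset.mem_filter] at this
    rcases this.2 with h | h
    · exact h.symm
    · exact absurd h (hind b hb a ha)

/-- Vertices in the same component of `G.induce s` are joined by a path inside `s`. -/
lemma SimpleGraph.Reachable.exists_isChain {V : Type*} {G : SimpleGraph V} {s : Set V} {u v : s}
    (h : (G.induce s).Reachable u v) :
    ∃ (w : List V) (hw : w ≠ []), w.Nodup ∧ w.IsChain G.Adj ∧ (∀ a ∈ w, a ∈ s) ∧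
      w.head hw = u ∧ w.getLast hw = v := by
  classical
  obtain ⟨p, hp⟩ := h.exists_isPath
  refine ⟨p.support.map Subtype.val, mt List.map_eq_nil_iff.1 p.support_ne_nil, ?_, ?_, ?_, ?_, ?_⟩
  · exact hp.support_nodup.map Subtype.val_injective
  · rw [List.isChain_map]
    exact p.isChain_adj_support
  · simp +contextual
  · rw [List.head_map, p.head_support]
  · rw [List.getLast_map, p.getLast_support]

/-- Every 1-tough `(K1 ∪ P3)`-free graph on `n ≥ 3` vertices is hamiltonian. -/
theorem stmt_6 {V : Type} [Fintype V] [DecidableEq V] (G : SimpleGraph V)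
    (hn : 3 ≤ Fintype.card V) (htough : OneTough G) (hfree : InducedFree K1P3 G) :
    G.IsHamiltonian := by
  classical
  obtain ⟨l, hl, hmax⟩ : ∃ l, IsCycleList G l ∧ ∀ l', IsCycleList G l' → l'.length ≤ l.length := by
    have hex : ∃ l, IsCycleList G l := by
      have := htough.not_isAcyclic hn
      simp only [IsAcyclic, not_forall, not_not] at this
      obtain ⟨_, c, hc⟩ := this
      exact hc.exists_isCycleList
    have hfin : (List.length '' {l | IsCycleList G l}).Finite :=
      (Set.finite_Iic (Fintype.card V)).subset
        (by rintro _ ⟨l, hl, rfl⟩; exact hl.1.length_le_card)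
    obtain ⟨_, ⟨l, hl, rfl⟩, hmax⟩ := Set.exists_max_image _ id hfin (Set.Nonempty.image _ hex)
    exact ⟨l, hl, fun l' h' => hmax _ ⟨l', h', rfl⟩⟩
  by_contra hham
  obtain ⟨h, hh⟩ : ∃ h, h ∉ l := by
    by_contra! hall
    exact hham (hl.isHamiltonian hall)
  let s : Set V := {v | v ∉ l}
  let H : V → Prop := fun v => ∃ hv : v ∈ s, (G.induce s).Reachable ⟨h, hh⟩ ⟨v, hv⟩
  have hHh : H h := ⟨hh, Reachable.refl _⟩
  have hHl : ∀ v, H v → v ∉ l := fun v hv => hv.1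
  have hHadj : ∀ u v, H u → G.Adj u v → v ∉ l → H v := by
    rintro u v ⟨hu, hr⟩ huv hv
    exact ⟨hv, hr.trans (Adj.reachable (G := G.induce s) (u := ⟨u, hu⟩) (v := ⟨v, hv⟩) huv)⟩
  have hpath : ∀ u v, H u → H v → ∃ (w : List V) (hw : w ≠ []), w.Nodup ∧ w.IsChain G.Adj ∧
      l.Disjoint w ∧ w.head hw = u ∧ w.getLast hw = v := by
    rintro u v ⟨hu, hru⟩ ⟨hv, hrv⟩
    obtain ⟨w, hw, h₁, h₂, h₃, h₄, h₅⟩ := (hru.symm.trans hrv).exists_isChain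
    exact ⟨w, hw, h₁, h₂, fun a hal haw => h₃ a haw hal, h₄, h₅⟩
  let N : Finset V := {x ∈ l.toFinset | ∃ u, H u ∧ G.Adj u x}
  have hN : ∀ x, x ∈ N ↔ x ∈ l ∧ ∃ u, H u ∧ G.Adj u x := by simp [N]
  have hsucc : ∀ x ∈ N, l.formPerm x ∉ N := by
    intro x hx hx'
    obtain ⟨hxl, u, hu, hux⟩ := (hN x).1 hx
    obtain ⟨-, v, hv, hvx⟩ := (hN _).1 hx'
    obtain ⟨w, hw, h₁, h₂, h₃, rfl, rfl⟩ := hpath u v hu hv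
    exact hl.not_adj_formPerm hmax hw h₁ h₂ h₃ hxl hux.symm hvx
  have hsucc_mem : ∀ x ∈ N, l.formPerm x ∈ l := fun x hx =>
    List.formPerm_apply_mem_of_mem ((hN x).1 hx).1
  have hsucc_nadj : ∀ x ∈ N, ∀ u, H u → ¬ G.Adj u (l.formPerm x) := fun x hx u hu hadj =>
    hsucc x hx ((hN _).2 ⟨hsucc_mem x hx, u, hu, hadj⟩)
  have hN2 : 2 ≤ N.card := by
    obtain ⟨c, hcl, hcN⟩ : ∃ c ∈ l, c ∉ N := by
      have hpos : 0 < l.length := by have := hl.2.1; lia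
      obtain ⟨c, hc⟩ := List.exists_mem_of_length_pos hpos
      by_cases hcN : c ∈ N
      · exact ⟨_, hsucc_mem c hcN, hsucc c hcN⟩
      · exact ⟨c, hc, hcN⟩
    have hc : ({h, c} : Finset V).card = 2 := Finset.card_pair (by rintro rfl; exact hh hcl)
    rw [← hc]
    refine htough.card_le N {h, c} H ?_ ?_ ?_ hc.ge
    · have key : ∀ u v, v ∉ N → G.Adj u v → H u → H v := fun u v hv huv hu =>
        hHadj u v hu huv fun hvl => hv ((hN v).2 ⟨hvl, u, hu, huv⟩)
      exact fun u v hu hv huv => propext ⟨key u v hv huv, key v u hu huv.symm⟩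
    · simp only [Finset.mem_insert, Finset.mem_singleton, forall_eq_or_imp, forall_eq]
      exact ⟨fun h' => hh ((hN h).1 h').1, hcN⟩
    · rw [Finset.coe_pair, Set.injOn_pair]
      intro h'
      exact absurd hcl (hHl c (h' ▸ hHh))
  let A : Finset V := insert h (N.image l.formPerm)
  have hAcard : A.card = N.card + 1 := by
    rw [Finset.card_insert_of_notMem, Finset.card_image_of_injective _ l.formPerm.injective]
    rw [Finset.mem_image]
    rintro ⟨x, hx, rfl⟩
    exact hh (hsucc_mem x hx)
  have hAind : G.IsIndepSet A := by
    intro a ha b hb hab hadj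
    simp only [A, Finset.coe_insert, Finset.coe_image, Set.mem_insert_iff, Set.mem_image,
      Finset.mem_coe] at ha hb
    rcases ha with rfl | ⟨x, hx, rfl⟩ <;> rcases hb with rfl | ⟨y, hy, rfl⟩
    · exact hab rfl
    · exact hsucc_nadj y hy _ hHh hadj
    · exact hsucc_nadj x hx _ hHh hadj.symm
    · obtain ⟨hxl, u, hu, hux⟩ := (hN x).1 hx
      obtain ⟨hyl, v, hv, hvy⟩ := (hN y).1 hy
      obtain ⟨w, hw, h₁, h₂, h₃, rfl, rfl⟩ := hpath u v hu hv
      exact hl.not_adj_formPerm_formPerm hmax hw h₁ h₂ h₃ hxl hyl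
        (fun h' => hab (congrArg _ h')) hux.symm hvy hadj
  have hle := htough.card_le_card_commonNeighbors hfree hAind (by lia)
    (S := {v | ∀ a ∈ A, G.Adj v a}) (by simp)
  have hsub : ({v | ∀ a ∈ A, G.Adj v a} : Finset V) ⊆ N := by
    intro v hv
    rw [Finset.mem_filter] at hv
    have hvh : G.Adj v h := hv.2 h (Finset.mem_insert_self _ _)
    refine (hN v).2 ⟨?_, h, hHh, hvh.symm⟩
    by_contra hvl
    have hHv : H v := hHadj h v hHh hvh.symm hvl
    obtain ⟨x, hx⟩ := Finset.card_pos.1 (by lia : 0 < N.card)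
    exact hsucc_nadj x hx v hHv
      (hv.2 _ (Finset.mem_insert_of_mem (Finset.mem_image_of_mem _ hx)))
  have := Finset.card_le_card hsub
  lia
end

section
/- Let H be the graph with vertex set {x1, x2, x3, x4, x5, x6, x7} and edge set consisting of the 6-cycle x1x2, x2x3, x3x4, x4x5, x5x6, x6x1 together with the edges x7x1, x7x4 and x2x6. Then H is not hamiltonian and has toughness exactly 1. -/
/-- The set of ratios `|S| / c(G − S)` over all vertex subsets `S` whose deletion leaves
a disconnected graph (at least two components); the toughness of a noncomplete graph is
the least element of this set. -/
def toughnessRatios {V : Type} [Fintype V] (G : SimpleGraph V) : Set ℚ :=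
  {r : ℚ | ∃ S : Finset V, 2 ≤ numCompDel G S ∧ r = (S.card : ℚ) / (numCompDel G S : ℚ)}

/-- The graph `H` on the vertices `x1, ..., x7` (represented by `0, ..., 6 : Fin 7`)
consisting of the 6-cycle `x1 x2 x3 x4 x5 x6 x1` together with the extra edges
`x7x1`, `x7x4` and `x2x6`. -/
def Hgraph : SimpleGraph (Fin 7) :=
  SimpleGraph.fromEdgeSet
    {s(0, 1), s(1, 2), s(2, 3), s(3, 4), s(4, 5), s(5, 0), s(6, 0), s(6, 3), s(1, 5)}

/-- A graph is not hamiltonian if some vertex is the neighbour of three distinct vertices each of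
which has at most two neighbours. -/
lemma not_isHamiltonian_of_three_neighbors {V : Type*} [Fintype V] [DecidableEq V]
    [Nontrivial V] {G : SimpleGraph V} {v a b c : V} (hab : a ≠ b) (hac : a ≠ c) (hbc : b ≠ c)
    (hdeg : ∀ w ∈ ({a, b, c} : Set V), v ∈ G.neighborSet w ∧ (G.neighborSet w).ncard ≤ 2) :
    ¬ G.IsHamiltonian := by
  intro hG
  obtain ⟨p, hp⟩ := hG.exists_isHamiltonianCycle v
  have htwo (w : V) : (p.toSubgraph.neighborSet w).ncard = 2 :=
    hp.isCycle.ncard_neighborSet_toSubgraph_eq_two (hp.mem_support w)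
  have hsub : ({a, b, c} : Set V) ⊆ p.toSubgraph.neighborSet v := by
    intro w hw
    obtain ⟨hvw, hcard⟩ := hdeg w hw
    have heq : p.toSubgraph.neighborSet w = G.neighborSet w :=
      Set.eq_of_subset_of_ncard_le (p.toSubgraph.neighborSet_subset w)
        (hcard.trans (htwo w).ge) (Set.toFinite _)
    rw [← heq] at hvw
    exact p.toSubgraph.adj_symm hvw
  have hle := Set.ncard_le_ncard hsub (Set.toFinite _)
  have hthree : ({a, b, c} : Set V).ncard = 3 := Set.ncard_eq_three.2 ⟨a, b, c, hab, hac, hbc, rfl⟩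
  have := htwo v
  omega

/-- For any priority function `p`, every component of `G - S` contains a vertex that is locally
minimal for `p`, so the number of components is at most the number of local minima. -/
lemma numCompDel_le_card_localMin {V : Type} [Fintype V] [DecidableEq V] (G : SimpleGraph V)
    [DecidableRel G.Adj] (S : Finset V) (p : V → ℕ) :
    numCompDel G S ≤
      (Finset.univ.filter fun v ↦ v ∉ S ∧ ∀ w, w ∉ S → G.Adj v w → p v ≤ p w).card := by
  classical
  set T := Finset.univ.filter fun v ↦ v ∉ S ∧ ∀ w, w ∉ S → G.Adj v w → p v ≤ p w with hT
  have hmem (t : T) : (t : V) ∈ ((↑S : Set V)ᶜ) := by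
    have := t.2
    simp only [hT, Finset.mem_filter] at this
    simpa using this.2.1
  let f : T → (G.induce ((↑S : Set V)ᶜ)).ConnectedComponent := fun t ↦
    SimpleGraph.connectedComponentMk _ ⟨t, hmem t⟩
  have hreach (n : ℕ) : ∀ v : ((↑S : Set V)ᶜ : Set V), p v = n →
      ∃ t : T, f t = SimpleGraph.connectedComponentMk _ v := by
    induction n using Nat.strong_induction_on with
    | _ n ih =>
      intro v hv
      by_cases hvT : (v : V) ∈ T
      · exact ⟨⟨v, hvT⟩, rfl⟩
      · have hvS : (v : V) ∉ S := fun h ↦ v.2 h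
        simp only [hT, Finset.mem_filter, Finset.mem_univ, true_and, not_and] at hvT
        have hex := hvT hvS
        push Not at hex
        obtain ⟨w, hw, hadj, hlt⟩ := hex
        obtain ⟨t, ht⟩ := ih (p w) (hv ▸ hlt) ⟨w, by simpa using hw⟩ rfl
        refine ⟨t, ht.trans (SimpleGraph.ConnectedComponent.sound ?_)⟩
        exact SimpleGraph.Adj.reachable (by simpa using hadj.symm)
  have hsurj : Function.Surjective f := fun C ↦
    C.ind fun v ↦ hreach (p v) v rfl
  have := Nat.card_le_card_of_surjective f hsurj
  simpa [numCompDel] using this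

lemma two_le_numCompDel_of_isolated {V : Type} [Fintype V] {G : SimpleGraph V} {S : Finset V}
    {u v : V} (hu : u ∉ S) (hv : v ∉ S) (huv : u ≠ v) (hiso : ∀ w, G.Adj u w → w ∈ S) :
    2 ≤ numCompDel G S := by
  let u' : ((↑S : Set V)ᶜ : Set V) := ⟨u, by simpa using hu⟩
  let v' : ((↑S : Set V)ᶜ : Set V) := ⟨v, by simpa using hv⟩
  have hne : (G.induce ((↑S : Set V)ᶜ)).connectedComponentMk u' ≠
      (G.induce ((↑S : Set V)ᶜ)).connectedComponentMk v' := by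
    intro h
    obtain ⟨q⟩ := SimpleGraph.ConnectedComponent.exact h
    have hnil : ¬ q.Nil := SimpleGraph.Walk.not_nil_of_ne fun h ↦ huv (congrArg Subtype.val h)
    have hadj := q.adj_snd hnil
    have hmem : (q.snd : V) ∉ S := fun h ↦ q.snd.2 h
    exact hmem (hiso _ (by simpa [u'] using hadj))
  have : Nontrivial (G.induce ((↑S : Set V)ᶜ)).ConnectedComponent := ⟨_, _, hne⟩
  exact Finite.one_lt_card

instance : DecidableRel Hgraph.Adj := fun a b ↦
  decidable_of_iff
    (s(a, b) ∈ ({s(0, 1), s(1, 2), s(2, 3), s(3, 4), s(4, 5), s(5, 0), s(6, 0), s(6, 3), s(1, 5)} :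
      Finset (Sym2 (Fin 7))) ∧ a ≠ b)
    (by simp [Hgraph])

lemma Hgraph_localMin_le (S : Finset (Fin 7)) :
    ∃ p ∈ ({![0, 1, 2, 3, 5, 4, 6], ![0, 1, 4, 3, 6, 5, 2]} : Finset (Fin 7 → ℕ)),
      (Finset.univ.filter fun v ↦ v ∉ S ∧ ∀ w, w ∉ S → Hgraph.Adj v w → p v ≤ p w).card ≤
        max 1 S.card := by
  revert S
  decide +kernel

lemma numCompDel_Hgraph_le (S : Finset (Fin 7)) : numCompDel Hgraph S ≤ max 1 S.card := by
  obtain ⟨p, -, hp⟩ := Hgraph_localMin_le S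
  refine (numCompDel_le_card_localMin Hgraph S p).trans (le_of_eq_of_le ?_ hp)
  congr

lemma Hgraph_not_isHamiltonian : ¬ Hgraph.IsHamiltonian := by
  refine not_isHamiltonian_of_three_neighbors (v := 3) (a := 2) (b := 4) (c := 6)
    (by decide) (by decide) (by decide) fun w hw ↦ ?_
  rw [← SimpleGraph.coe_neighborFinset, Set.ncard_coe_finset, Finset.mem_coe,
    SimpleGraph.mem_neighborFinset]
  rcases hw with rfl | rfl | rfl <;> decide

/-- The graph `H` is not hamiltonian and has toughness exactly `1`. -/
theorem stmt_8 : ¬ Hgraph.IsHamiltonian ∧ IsLeast (toughnessRatios Hgraph) 1 := by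
  refine ⟨Hgraph_not_isHamiltonian, ⟨{0, 3}, ?_, ?_⟩, ?_⟩
  · exact two_le_numCompDel_of_isolated (u := 6) (v := 1) (by decide) (by decide) (by decide)
      (by decide)
  · have hge : 2 ≤ numCompDel Hgraph {0, 3} :=
      two_le_numCompDel_of_isolated (u := 6) (v := 1) (by decide) (by decide) (by decide)
        (by decide)
    have hcard : ({0, 3} : Finset (Fin 7)).card = 2 := by decide
    have hle := numCompDel_Hgraph_le {0, 3}
    rw [hcard] at hle
    have heq : numCompDel Hgraph {0, 3} = 2 := le_antisymm hle hge
    rw [heq, hcard]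
    norm_num
  · rintro r ⟨S, hS, rfl⟩
    have hle : numCompDel Hgraph S ≤ S.card := by
      have := numCompDel_Hgraph_le S
      omega
    rw [le_div_iff₀ (by exact_mod_cast (by omega : 0 < numCompDel Hgraph S)), one_mul]
    exact_mod_cast hle
end

section
/- The Petersen graph is not hamiltonian and has toughness exactly 4/3. -/
/-- The Petersen graph: vertices are the 2-element subsets of a 5-element set, with two
vertices adjacent if and only if the corresponding subsets are disjoint. -/
def petersen : SimpleGraph {s : Finset (Fin 5) // s.card = 2} :=
  SimpleGraph.fromRel (fun a b => Disjoint a.1 b.1)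

/-! ### A numerical model of the Petersen graph -/

/-- The two-element subsets of `Fin 5`, in lexicographic order. -/
def petersenVertex : Fin 10 → {s : Finset (Fin 5) // s.card = 2} :=
  ![⟨{0, 1}, rfl⟩, ⟨{0, 2}, rfl⟩, ⟨{0, 3}, rfl⟩, ⟨{0, 4}, rfl⟩, ⟨{1, 2}, rfl⟩,
    ⟨{1, 3}, rfl⟩, ⟨{1, 4}, rfl⟩, ⟨{2, 3}, rfl⟩, ⟨{2, 4}, rfl⟩, ⟨{3, 4}, rfl⟩]

/-- The position of a vertex of the Petersen graph in the enumeration `petersenVertex`. -/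
noncomputable def petersenIndex : {s : Finset (Fin 5) // s.card = 2} ≃ Fin 10 :=
  (Equiv.ofBijective petersenVertex (by decide +kernel)).symm

/-- The set of neighbours of the `i`-th vertex of the Petersen graph, as a bit mask: the
numeral is the adjacency matrix, ten bits per row. -/
def petersenNbrs (i : ℕ) : ℕ :=
  (23565677339727826199534732160 >>> (10 * i)) % 1024

lemma petersen_adj_iff (u v : {s : Finset (Fin 5) // s.card = 2}) :
    petersen.Adj u v ↔ (petersenNbrs (petersenIndex u)).testBit (petersenIndex v) := by
  have key : ∀ i j : Fin 10,
      (petersenVertex i ≠ petersenVertex j ∧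
        (Disjoint (petersenVertex i).1 (petersenVertex j).1 ∨
          Disjoint (petersenVertex j).1 (petersenVertex i).1)) ↔
      (petersenNbrs i).testBit j := by decide +kernel
  obtain ⟨i, rfl⟩ := petersenIndex.symm.surjective u
  obtain ⟨j, rfl⟩ := petersenIndex.symm.surjective v
  rw [Equiv.apply_symm_apply, Equiv.apply_symm_apply]
  exact key i j

lemma testBit_petersenNbrs_lt {i j : ℕ} (h : (petersenNbrs i).testBit j) : j < 10 := by
  by_contra! hj
  rw [petersenNbrs, Nat.testBit_lt_two_pow] at h
  · simp at h
  · exact (Nat.mod_lt _ (by norm_num)).trans_le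
      (Nat.pow_le_pow_right (n := 2) (by norm_num) hj)

/-! ### The Petersen graph is not hamiltonian -/

/-- Whether some walk of length `n` from vertex `u` to vertex `0` avoids the vertices in the bit
mask `visited`, as well as repetitions, after its starting point. -/
def petersenSearch : ℕ → ℕ → ℕ → Bool
  | 0, u, _ => u == 0
  | n + 1, u, visited => (List.range 10).any fun w =>
      (petersenNbrs u).testBit w && !visited.testBit w && petersenSearch n w (visited ||| 2 ^ w)

lemma petersenSearch_length {u v : {s : Finset (Fin 5) // s.card = 2}} (p : petersen.Walk u v)
    (hv : petersenIndex v = 0) (visited : ℕ) (hp : p.support.tail.Nodup)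
    (hvis : ∀ x ∈ p.support.tail, visited.testBit (petersenIndex x) = false) :
    petersenSearch p.length (petersenIndex u) visited := by
  induction p generalizing visited with
  | nil => simp [petersenSearch, hv]
  | @cons u w v huw p ih =>
    rw [SimpleGraph.Walk.support_cons, List.tail_cons] at hp hvis
    rw [← p.cons_tail_support, List.nodup_cons] at hp
    rw [← p.cons_tail_support] at hvis
    simp only [SimpleGraph.Walk.length_cons, petersenSearch, List.any_eq_true, List.mem_range,
      Bool.and_eq_true, Bool.not_eq_true']
    refine ⟨petersenIndex w, (petersenIndex w).isLt,
      ⟨(petersen_adj_iff _ _).1 huw, hvis w List.mem_cons_self⟩, ih hv _ hp.2 fun x hx => ?_⟩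
    have hwx : (petersenIndex w : ℕ) ≠ petersenIndex x := fun h =>
      hp.1 (petersenIndex.injective (Fin.ext h) ▸ hx)
    rw [Nat.testBit_or, hvis x (List.mem_cons_of_mem _ hx), Nat.testBit_two_pow_of_ne hwx]
    rfl

lemma not_isHamiltonian_petersen : ¬ petersen.IsHamiltonian := by
  intro h
  have : Nontrivial {s : Finset (Fin 5) // s.card = 2} := petersenIndex.nontrivial
  obtain ⟨p, hp⟩ := h.exists_isHamiltonianCycle (petersenIndex.symm 0)
  have key := petersenSearch_length p (by simp) 0 hp.isCycle.support_nodup (by simp)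
  rw [hp.length_eq, Fintype.card_congr petersenIndex, Fintype.card_fin,
    Equiv.apply_symm_apply] at key
  have hno : petersenSearch 10 0 0 = false := by decide +kernel
  simp [hno] at key

/-! ### Counting components -/

lemma card_le_numCompDel {V α : Type} [Fintype V] [Fintype α] (G : SimpleGraph V) (S : Finset V)
    (f : V → α) (hf : ∀ u v, u ∉ S → v ∉ S → G.Adj u v → f u = f v)
    (hsurj : ∀ a, ∃ v, v ∉ S ∧ f v = a) : Fintype.card α ≤ numCompDel G S := by
  let g : (G.induce ((↑S : Set V)ᶜ)).ConnectedComponent → α :=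
    SimpleGraph.ConnectedComponent.lift (fun v => f v) fun u v p _ => by
      clear * - p hf
      induction p with
      | nil => rfl
      | @cons u v _ huv _ ih =>
        exact (hf _ _ u.2 v.2 huv).trans ih
  rw [numCompDel, ← Nat.card_eq_fintype_card]
  refine Nat.card_le_card_of_surjective g fun a => ?_
  obtain ⟨v, hv, rfl⟩ := hsurj a
  exact ⟨SimpleGraph.connectedComponentMk _ ⟨v, by simpa using hv⟩, rfl⟩

/-- One sweep of a flood fill in the Petersen graph: each vertex in turn, if it lies in the bit
mask `R`, contributes its neighbours lying in the bit mask `avail`. -/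
def petersenSweep (avail R : ℕ) : ℕ :=
  (List.range 10).foldl
    (fun R j => if R.testBit j then R ||| (petersenNbrs j &&& avail) else R) R

lemma testBit_petersenSweep {avail R : ℕ} {P : ℕ → Prop}
    (hP : ∀ i j, P i → (petersenNbrs i).testBit j → avail.testBit j → P j)
    (hR : ∀ i, R.testBit i → P i) (i : ℕ) (hi : (petersenSweep avail R).testBit i) : P i := by
  suffices ∀ (l : List ℕ) (R : ℕ), (∀ i, R.testBit i → P i) → ∀ i, (l.foldl
      (fun R j => if R.testBit j then R ||| (petersenNbrs j &&& avail) else R) R).testBit i → P i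
    from this _ R hR i hi
  intro l
  induction l with
  | nil => exact fun _ hR => hR
  | cons j l ih =>
    refine fun R hR => ih _ fun i hi => ?_
    dsimp only at hi
    split_ifs at hi with hj
    · simp only [Nat.testBit_or, Nat.testBit_and, Bool.or_eq_true, Bool.and_eq_true] at hi
      exact hi.elim (hR i) fun h => hP j i (hR j hj) h.1 h.2
    · exact hR i hi

/-- The vertices of the bit mask `avail` from which two flood-fill sweeps inside `avail` meet no
smaller vertex. -/
def petersenRoots (avail : ℕ) : Finset ℕ :=
  (Finset.range 10).filter fun j => avail.testBit j ∧
    petersenSweep avail (petersenSweep avail (2 ^ j)) % 2 ^ j = 0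

lemma card_petersenRoots : ∀ avail < 1024, (petersenRoots avail).card ≤ 1 ∨
    4 * (petersenRoots avail).card ≤
      3 * ((Finset.range 10).filter fun j => avail.testBit j = false).card := by
  decide +kernel

/-- The complement of a set of vertices of the Petersen graph, as a bit mask. -/
noncomputable def petersenComplMask (S : Finset {s : Finset (Fin 5) // s.card = 2}) : ℕ :=
  Nat.ofBits fun i : Fin 10 => decide (petersenIndex.symm i ∉ S)

lemma testBit_petersenComplMask (S : Finset {s : Finset (Fin 5) // s.card = 2})
    (i : Fin 10) : (petersenComplMask S).testBit i = decide (petersenIndex.symm i ∉ S) := by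
  simp [petersenComplMask]

lemma card_testBit_petersenComplMask (S : Finset {s : Finset (Fin 5) // s.card = 2}) :
    ((Finset.range 10).filter fun j => (petersenComplMask S).testBit j = false).card = S.card := by
  symm
  refine Finset.card_bij (fun v _ => (petersenIndex v : ℕ)) (fun v hv => ?_)
    (fun u _ v _ h => petersenIndex.injective (Fin.ext h)) fun j hj => ?_
  · simp [testBit_petersenComplMask, hv]
  · obtain ⟨hj, hb⟩ := Finset.mem_filter.1 hj
    have := testBit_petersenComplMask S ⟨j, Finset.mem_range.1 hj⟩
    refine ⟨petersenIndex.symm ⟨j, Finset.mem_range.1 hj⟩, ?_, by simp⟩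
    simpa [hb] using this

lemma numCompDel_petersen_le (S : Finset {s : Finset (Fin 5) // s.card = 2}) :
    numCompDel petersen S ≤ (petersenRoots (petersenComplMask S)).card := by
  classical
  let H := petersen.induce ((↑S : Set {s : Finset (Fin 5) // s.card = 2})ᶜ)
  let P (c : H.ConnectedComponent) (i : ℕ) : Prop :=
    ∃ v, H.connectedComponentMk v = c ∧ (petersenIndex v.1 : ℕ) = i
  have hex (c) : ∃ i, P c i := c.ind fun v => ⟨_, v, rfl, rfl⟩
  have hclosed (c) (i j : ℕ) : P c i → (petersenNbrs i).testBit j →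
      (petersenComplMask S).testBit j → P c j := by
    rintro ⟨v, rfl, rfl⟩ hij hj
    lift j to Fin 10 using testBit_petersenNbrs_lt hij
    rw [testBit_petersenComplMask, decide_eq_true_eq] at hj
    let w : ((↑S : Set {s : Finset (Fin 5) // s.card = 2})ᶜ : Set _) :=
      ⟨petersenIndex.symm j, by simpa using hj⟩
    have hvw : H.Adj v w := (petersen_adj_iff _ _).2 (by simpa [w] using hij)
    exact ⟨w, SimpleGraph.ConnectedComponent.sound hvw.symm.reachable, by simp [w]⟩
  have hroot (c) : Nat.find (hex c) ∈ petersenRoots (petersenComplMask S) := by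
    obtain ⟨v, -, hv⟩ := Nat.find_spec (hex c)
    rw [petersenRoots, Finset.mem_filter, Finset.mem_range]
    refine ⟨hv ▸ (petersenIndex v.1).isLt, ?_, Nat.eq_of_testBit_eq fun i => ?_⟩
    · rw [← hv, testBit_petersenComplMask]
      simpa using Finset.mem_coe.not.1 v.2
    · rw [Nat.testBit_mod_two_pow, Nat.zero_testBit, Bool.and_eq_false_iff, decide_eq_false_iff_not,
        or_iff_not_imp_left, not_not, ← Bool.not_eq_true]
      refine fun hi hbit => Nat.find_min (hex c) hi ?_
      refine testBit_petersenSweep (hclosed c) (testBit_petersenSweep (hclosed c) fun k hk => ?_)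
        i hbit
      rw [Nat.testBit_two_pow, decide_eq_true_eq] at hk
      exact hk ▸ Nat.find_spec (hex c)
  have hinj : Function.Injective fun c =>
      (⟨Nat.find (hex c), hroot c⟩ : petersenRoots (petersenComplMask S)) := by
    intro c d hcd
    obtain ⟨v, hvc, hv⟩ := Nat.find_spec (hex c)
    obtain ⟨w, hwd, hw⟩ := Nat.find_spec (hex d)
    have hvw : v = w := Subtype.ext (petersenIndex.injective (Fin.ext
      (hv.trans ((Subtype.ext_iff.1 hcd).trans hw.symm))))
    rw [← hvc, ← hwd, hvw]
  exact (Nat.card_le_card_of_injective _ hinj).trans_eq (by simp)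

lemma four_mul_numCompDel_petersen_le {S : Finset {s : Finset (Fin 5) // s.card = 2}}
    (hS : 2 ≤ numCompDel petersen S) : 4 * numCompDel petersen S ≤ 3 * S.card := by
  have hle := numCompDel_petersen_le S
  have hcard := card_petersenRoots (petersenComplMask S) (Nat.ofBits_lt_two_pow _)
  rw [card_testBit_petersenComplMask] at hcard
  lia

/-- The two-element subsets of `{1, 2, 3, 4}`, grouped into complementary pairs; the value at the
other vertices of the Petersen graph is irrelevant. -/
def petersenMatching (v : {s : Finset (Fin 5) // s.card = 2}) : Fin 3 :=
  if v.1 = {1, 2} ∨ v.1 = {3, 4} then 0 else if v.1 = {1, 3} ∨ v.1 = {2, 4} then 1 else 2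

lemma three_le_numCompDel_petersen :
    3 ≤ numCompDel petersen (Finset.univ.filter fun v => 0 ∈ v.1) := by
  have hconst : ∀ u v : {s : Finset (Fin 5) // s.card = 2}, 0 ∉ u.1 → 0 ∉ v.1 →
      Disjoint u.1 v.1 → petersenMatching u = petersenMatching v := by decide +kernel
  have hsurj : ∀ a, ∃ v : {s : Finset (Fin 5) // s.card = 2},
      0 ∉ v.1 ∧ petersenMatching v = a := by decide +kernel
  refine card_le_numCompDel (α := Fin 3) petersen _ petersenMatching (fun u v hu hv huv => ?_)
    (by simpa using hsurj)
  exact hconst u v (by simpa using hu) (by simpa using hv) (huv.2.elim id fun h => h.symm)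

/-- The Petersen graph is not hamiltonian and has toughness exactly `4/3`. -/
theorem stmt_10 : ¬ petersen.IsHamiltonian ∧ IsLeast (toughnessRatios petersen) (4 / 3) := by
  refine ⟨not_isHamiltonian_petersen, ?_, ?_⟩
  · have hge := three_le_numCompDel_petersen
    have hle := four_mul_numCompDel_petersen_le (le_of_lt hge)
    have hcard : (Finset.univ.filter fun v : {s : Finset (Fin 5) // s.card = 2} =>
        0 ∈ v.1).card = 4 := by decide +kernel
    refine ⟨_, le_of_lt hge, ?_⟩
    rw [hcard] at hle ⊢
    rw [le_antisymm (by lia) hge]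
    norm_num
  · rintro r ⟨S, hS, rfl⟩
    have hle : (4 * numCompDel petersen S : ℚ) ≤ 3 * S.card :=
      mod_cast four_mul_numCompDel_petersen_le hS
    have hpos : (0 : ℚ) < numCompDel petersen S := mod_cast (by lia : 0 < numCompDel petersen S)
    rw [div_le_div_iff₀ (by norm_num) hpos]
    linarith
end

section
/- Let G be a (K1 ∪ P2)-free graph and let C be a longest cycle of G. Then the set V(G) \ V(C) of vertices not on C is an independent set; in particular, every longest cycle of G is a dominating cycle. -/
/-- In a `(K1 ∪ P2)`-free graph every vertex is adjacent to an endpoint of every edge. -/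
theorem InducedFree.adj_or_adj {V : Type*} {G : SimpleGraph V} (hfree : InducedFree K1P2 G)
    {x y : V} (hxy : G.Adj x y) (z : V) : G.Adj z x ∨ G.Adj z y := by
  by_contra! h
  obtain ⟨hzx, hzy⟩ := h
  have hx : z ≠ x := by rintro rfl; exact hzy hxy
  have hy : z ≠ y := by rintro rfl; exact hzx hxy.symm
  refine hfree ⟨⟨⟨![z, x, y], ?_⟩, ?_⟩⟩
  · intro i j
    fin_cases i <;> fin_cases j <;> simp [hx, hy, hx.symm, hy.symm, hxy.ne, hxy.ne']
  · intro i j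
    change G.Adj (![z, x, y] i) (![z, x, y] j) ↔ K1P2.Adj i j
    fin_cases i <;> fin_cases j <;>
      simp [K1P2, hxy, hxy.symm, hzx, hzy, G.adj_comm x z, G.adj_comm y z]

/-- Joining the ends of a path through a new vertex gives a cycle. -/
theorem isCycle_cons_cons_of_isPath {V : Type*} {G : SimpleGraph V} {u a v : V}
    (hua : G.Adj u a) (hav : G.Adj a v) (huv : u ≠ v) {q : G.Walk v u} (hq : q.IsPath)
    (ha : a ∉ q.support) : ((q.cons hav).cons hua).IsCycle := by
  refine (SimpleGraph.Walk.cons_isCycle_iff _ hua).2 ⟨hq.cons ha, ?_⟩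
  rw [SimpleGraph.Walk.edges_cons, List.mem_cons, not_or]
  refine ⟨?_, fun h => ha (q.snd_mem_support_of_mem_edges h)⟩
  simp [huv, hua.ne]

/-- Let `G` be a `(K1 ∪ P2)`-free graph and let `C` (given as a closed walk `p` that is a
cycle of maximum length among all cycles of `G`) be a longest cycle of `G`. Then the set of
vertices not on `C` is independent: no two vertices outside `C` are adjacent. In
particular, every longest cycle of `G` is a dominating cycle. -/
theorem stmt_14 {V : Type} (G : SimpleGraph V) (hfree : InducedFree K1P2 G)
    (u : V) (p : G.Walk u u) (hcyc : p.IsCycle)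
    (hlongest : ∀ (w : V) (q : G.Walk w w), q.IsCycle → q.length ≤ p.length) :
    ∀ x y : V, x ∉ p.support → y ∉ p.support → ¬ G.Adj x y := by
  intro x y hx hy hxy
  cases p with
  | nil => exact hcyc.not_nil .nil
  | @cons _ v _ huv q =>
    obtain ⟨hq, -⟩ := (SimpleGraph.Walk.cons_isCycle_iff q huv).1 hcyc
    have hxq : x ∉ q.support := fun h => hx (List.mem_cons_of_mem _ h)
    have hyq : y ∉ q.support := fun h => hy (List.mem_cons_of_mem _ h)
    have hone {a : V} (ha : a ∉ q.support) (hua : G.Adj u a) (hav : G.Adj a v) : False := by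
      simpa using hlongest _ _ (isCycle_cons_cons_of_isPath hua hav huv.ne hq ha)
    have htwo {a b : V} (ha : a ∉ q.support) (hb : b ∉ q.support)
        (hua : G.Adj u a) (hab : G.Adj a b) (hbv : G.Adj b v) : False := by
      have hub : u ≠ b := fun h => hb (h ▸ q.end_mem_support)
      have haq : a ∉ (q.cons hbv).support := by simp [hab.ne, ha]
      have := hlongest _ _ (isCycle_cons_cons_of_isPath hua hab hub (hq.cons hb) haq)
      simp at this
    rcases hfree.adj_or_adj hxy u with hu | hu <;>
      rcases hfree.adj_or_adj hxy v with hv | hv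
    · exact hone hxq hu hv.symm
    · exact htwo hxq hyq hu hxy hv.symm
    · exact htwo hyq hxq hu hxy.symm hv.symm
    · exact hone hyq hu hv.symm
end
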